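/- arXiv:1510.04319 — 3 statements merged into one kernel-verified Lean document; each statement's English description precedes it below -/
import Mathlib

section
/- Let Γ = {1324, 123}. Then for all n ≥ 0, U_{Γ,2n}(y) = Σ_{k=0}^{n} [ (2k+1)·binom(2n, n−k) / (n+k+1) ]·(−y)^{n+k}. -/
open Polynomial

/-- The reduction of a list of distinct integers: replace the i-th smallest entry by i. -/
def redL (l : List ℕ) : List ℕ :=
  l.map (fun x => (l.countP (fun y => decide (y < x))) + 1)

/-- The number of descents of a list. -/
def desL (l : List ℕ) : ℕ :=
  (l.zip l.tail).countP (fun p => decide (p.2 < p.1))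

/-- `σ` has a `Γ`-match: some consecutive factor of length at least 2 reduces to a member of `Γ`. -/
def HasMatch (Γ : Set (List ℕ)) (l : List ℕ) : Prop :=
  ∃ i j : ℕ, 1 ≤ j ∧ i + j + 1 ≤ l.length ∧ redL ((l.drop i).take (j + 1)) ∈ Γ

open scoped Classical in
/-- The set of permutations of `{1,…,n}` (in one-line notation, as lists) with no `Γ`-match. -/
noncomputable def NMfinset (Γ : Set (List ℕ)) (n : ℕ) : Finset (List ℕ) :=
  ((List.range' 1 n).permutations.toFinset).filter (fun l => ¬ HasMatch Γ l)

/-- `NM_{Γ,n}(y) = Σ_{σ ∈ NM_n(Γ)} y^{1+des(σ)}` for `n ≥ 1`, and `NM_{Γ,0}(y) = 1`. -/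
noncomputable def NMpoly (Γ : Set (List ℕ)) (n : ℕ) : Polynomial ℚ :=
  if n = 0 then 1 else ∑ l ∈ NMfinset Γ n, X ^ (1 + desL l)


namespace BR

/-- Polynomials counting weighted paths. -/
noncomputable def e : ℕ → ℕ → ℚ[X]
  | 0, 0 => 1
  | _ + 1, 0 => 0
  | 0, q + 1 => -X * e 0 q + e 1 q
  | p + 1, q + 1 => -X * e p q + e (p + 2) q

lemma e_sum (q : ℕ) : ∀ p, e (p + 1) q = ∑ i ∈ Finset.range q, -X * e (p + i) (q - 1 - i) := by
  induction q with
  | zero => intro p; simp [e]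
  | succ q ih =>
    intro p
    rw [Finset.sum_range_succ', e, ih (p + 1), add_comm]
    congr 1
    apply Finset.sum_congr rfl
    intro i hi
    have : q + 1 - 1 - (i + 1) = q - 1 - i := by omega
    rw [this, show p + 1 + i = p + (i + 1) by ring]

/-- ballot numbers -/
def bal (q : ℕ) : ℕ → ℚ
  | 0 => 1
  | u + 1 => (q.choose (u + 1) : ℚ) - q.choose u

lemma bal_succ (q u : ℕ) : bal (q + 1) (u + 1) = bal q (u + 1) + bal q u := by
  cases u with
  | zero => simp [bal]
  | succ u =>
    simp only [bal, Nat.choose_succ_succ' q]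
    push_cast; ring

lemma bal_half (u : ℕ) : bal (2 * u + 1) (u + 1) = 0 := by
  simp only [bal]
  rw [sub_eq_zero]
  congr 1
  apply Nat.choose_symm_of_eq_add
  ring

/-- closed form -/
noncomputable def ec (p q : ℕ) : ℚ[X] :=
  ∑ u ∈ Finset.range (q + 1), if 2 * u + p ≤ q then C (bal q u) * (-X : ℚ[X]) ^ (q - u) else 0

lemma ec_aux (p q N : ℕ) (h : q + 1 ≤ N) : ec p q =
    ∑ u ∈ Finset.range N, if 2 * u + p ≤ q then C (bal q u) * (-X : ℚ[X]) ^ (q - u) else 0 := by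
  rw [ec]
  apply Finset.sum_subset
  · intro x; simp only [Finset.mem_range]; omega
  · intro x _ hx
    simp only [Finset.mem_range] at hx
    rw [if_neg (by omega)]

lemma ec_rec (p q : ℕ) : ec (p + 1) (q + 1) = -X * ec p q + ec (p + 2) q := by
  rw [ec_aux p q (q + 1 + 1) (by omega), ec_aux (p + 2) q (q + 1) le_rfl, ec,
    Finset.sum_range_succ' _ (q + 1), Finset.sum_range_succ' _ (q + 1), mul_add, Finset.mul_sum, add_right_comm,
    ← Finset.sum_add_distrib]
  congr 1
  · apply Finset.sum_congr rfl
    intro u _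
    by_cases h : 2 * (u + 1) + p ≤ q
    · rw [if_pos (by omega), if_pos h, if_pos (by omega), bal_succ]
      have h1 : q + 1 - (u + 1) = (q - (u + 1)) + 1 := by omega
      have h2 : q - u = (q - (u + 1)) + 1 := by omega
      rw [h1, h2, C_add]; ring
    · rw [if_neg (by omega), if_neg h, if_neg (by omega)]; simp
  · by_cases h : p ≤ q
    · rw [if_pos (by omega), if_pos (by omega)]
      simp [bal]; ring
    · rw [if_neg (by omega), if_neg (by omega)]; simp

lemma ec_rec0 (q : ℕ) : ec 0 (q + 1) = -X * ec 0 q + ec 1 q := by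
  rw [ec_aux 0 q (q + 1 + 1) (by omega), ec_aux 1 q (q + 1) le_rfl, ec,
    Finset.sum_range_succ' _ (q + 1), Finset.sum_range_succ' _ (q + 1), mul_add, Finset.mul_sum, add_right_comm,
    ← Finset.sum_add_distrib]
  congr 1
  · apply Finset.sum_congr rfl
    intro u _
    by_cases h : 2 * (u + 1) + 0 ≤ q
    · rw [if_pos (by omega), if_pos h, if_pos (by omega), bal_succ]
      have h1 : q + 1 - (u + 1) = (q - (u + 1)) + 1 := by omega
      have h2 : q - u = (q - (u + 1)) + 1 := by omega
      rw [h1, h2, C_add]; ring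
    · by_cases h' : q = 2 * u + 1
      · subst h'
        rw [if_pos (by omega), if_neg h, if_pos (by omega), bal_succ, bal_half]
        have h1 : 2 * u + 1 + 1 - (u + 1) = 2 * u + 1 - u := by omega
        rw [h1]; simp
      · rw [if_neg (by omega), if_neg h, if_neg (by omega)]; simp
  · simp [bal]; ring

lemma e_eq_ec (q : ℕ) : ∀ p, e p q = ec p q := by
  induction q with
  | zero =>
    intro p
    cases p with
    | zero => simp [e, ec, bal]
    | succ p => simp [e, ec]
  | succ q ih =>
    intro p
    cases p with
    | zero => rw [e, ec_rec0, ih, ih]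
    | succ p => rw [e, ec_rec, ih, ih]

lemma bal_formula (n k : ℕ) (hk : k ≤ n) :
    bal (2 * n) (n - k) = (2 * (k : ℚ) + 1) * ((2 * n).choose (n - k) : ℚ) / ((n : ℚ) + k + 1) := by
  obtain ⟨m, rfl⟩ := Nat.exists_eq_add_of_le hk
  rw [Nat.add_sub_cancel_left]
  have h0 : (((k + m : ℕ) : ℚ) + k + 1) ≠ 0 := by positivity
  rw [eq_div_iff h0]
  cases m with
  | zero => simp [bal]; ring
  | succ m =>
    simp only [bal]
    have := Nat.choose_succ_right_eq (2 * (k + (m + 1))) m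
    have h2 : 2 * (k + (m + 1)) - m = 2 * k + m + 2 := by omega
    rw [h2] at this
    have h3 : ((2 * (k + (m + 1))).choose (m + 1) : ℚ) * (m + 1)
      = (2 * (k + (m + 1))).choose m * (2 * k + m + 2) := by exact_mod_cast this
    push_cast at h3 ⊢
    linear_combination h3

lemma e_final (n : ℕ) : e 0 (2 * n) = ∑ k ∈ Finset.range (n + 1),
        Polynomial.C ((2 * (k : ℚ) + 1) * ((2 * n).choose (n - k) : ℚ) / ((n : ℚ) + k + 1)) *
          (-X : Polynomial ℚ) ^ (n + k) := by
  rw [e_eq_ec, ec, ← Finset.sum_range_reflect (n := n + 1)]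
  symm
  have : ∑ u ∈ Finset.range (n + 1), (if 2 * u + 0 ≤ 2 * n then
      C (bal (2 * n) u) * (-X : ℚ[X]) ^ (2 * n - u) else 0) =
      ∑ u ∈ Finset.range (2 * n + 1), (if 2 * u + 0 ≤ 2 * n then
      C (bal (2 * n) u) * (-X : ℚ[X]) ^ (2 * n - u) else 0) := by
    apply Finset.sum_subset
    · intro x; simp only [Finset.mem_range]; omega
    · intro x _ hx
      simp only [Finset.mem_range] at hx
      rw [if_neg (by omega)]
  rw [← this]
  apply Finset.sum_congr rfl
  intro u hu
  simp only [Finset.mem_range] at hu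
  rw [if_pos (by omega), ← bal_formula n _ (by omega)]
  congr 3 <;> omega

/-- Blocks `(a,c)` with `a ≤ c` in `V`. -/
def blk (V : Finset ℕ) : Finset (ℕ × ℕ) := (V ×ˢ V).filter (fun b => b.1 ≤ b.2)

def rm (V : Finset ℕ) (b : ℕ × ℕ) : Finset ℕ := (V.erase b.1).erase b.2

lemma mem_blk {V b} : b ∈ blk V ↔ b.1 ∈ V ∧ b.2 ∈ V ∧ b.1 ≤ b.2 := by
  simp [blk, and_assoc]

lemma mem_rm {V b x} : x ∈ rm V b ↔ x ∈ V ∧ x ≠ b.1 ∧ x ≠ b.2 := by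
  simp [rm]; tauto

lemma rm_card_lt {V b} (h : b ∈ blk V) : (rm V b).card < V.card := by
  apply Finset.card_lt_card
  rw [Finset.ssubset_iff_of_subset]
  · exact ⟨b.1, (mem_blk.1 h).1, by simp [mem_rm]⟩
  · intro x hx; exact (mem_rm.1 hx).1

def G (b b' : ℕ × ℕ) : Prop := b.2 < b'.1 ∨ (b.1 < b'.1 ∧ b'.1 < b.2 ∧ b.2 < b'.2)

open scoped Classical in
noncomputable def cs (w : ℚ[X]) (r : ℕ × ℕ → ℕ × ℕ → Prop) (b : ℕ × ℕ) (V : Finset ℕ) : ℚ[X] :=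
  if V = ∅ then 1 else
    ∑ b' : {b' // b' ∈ (blk V).filter (r b)}, w * cs w r b'.1 (rm V b'.1)
termination_by V.card
decreasing_by exact rm_card_lt (Finset.mem_filter.1 b'.2).1

lemma cs_eq (w r b) {V : Finset ℕ} (hV : V ≠ ∅) [DecidablePred (r b)] :
    cs w r b V = ∑ b' ∈ (blk V).filter (r b), w * cs w r b' (rm V b') := by
  classical
  rw [cs, if_neg hV]
  refine (Finset.sum_coe_sort (@Finset.filter _ (r b) (fun a => Classical.propDecidable (r b a)) (blk V))
    (fun b' => w * cs w r b' (rm V b'))).trans ?_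
  congr!

lemma cs_empty (w r b) : cs w r b ∅ = 1 := by
  rw [cs, if_pos rfl]

/-- unconstrained version for the complementary relation -/
noncomputable def P (V : Finset ℕ) : ℚ[X] :=
  if V = ∅ then 1 else ∑ b' ∈ blk V, X * cs X (fun b b' => ¬ G b b') b' (rm V b')

noncomputable abbrev E := cs (-X) G
noncomputable abbrev Q := cs X (fun b b' => ¬ G b b')

lemma sum_powerset_first (b : ℕ × ℕ) (V : Finset ℕ) (f : Finset ℕ → ℚ[X]) :
    ∑ S ∈ V.powerset, E b S * f (V \ S) = f V +
      open scoped Classical in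
      ∑ b' ∈ (blk V).filter (G b), -X * ∑ S ∈ (rm V b').powerset, E b' S * f (rm V b' \ S) := by
  classical
  rw [← Finset.add_sum_erase _ _ (Finset.empty_mem_powerset V)]
  simp only [E, cs_empty, one_mul, Finset.sdiff_empty]
  congr 1
  have h1 : ∀ S ∈ V.powerset.erase ∅, cs (-X) G b S * f (V \ S) =
      ∑ b' ∈ (blk S).filter (G b), -X * cs (-X) G b' (rm S b') * f (V \ S) := by
    intro S hS
    rw [cs_eq _ _ _ (Finset.mem_erase.1 hS).1, Finset.sum_mul]
  rw [Finset.sum_congr rfl h1]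
  simp only [Finset.mul_sum]
  rw [Finset.sum_sigma', Finset.sum_sigma']
  refine Finset.sum_bij' (fun x _ => ⟨x.2, rm x.1 x.2⟩)
    (fun x _ => ⟨insert x.1.1 (insert x.1.2 x.2), x.1⟩) ?_ ?_ ?_ ?_ ?_
  · rintro ⟨S, c⟩ h
    simp only [Finset.mem_sigma, Finset.mem_erase, Finset.mem_powerset, Finset.mem_filter,
      mem_blk] at h ⊢
    obtain ⟨⟨h1, h2⟩, ⟨h3, h4, h5⟩, h6⟩ := h
    refine ⟨⟨⟨h2 h3, h2 h4, h5⟩, h6⟩, ?_⟩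
    intro x hx
    rw [mem_rm] at hx ⊢
    exact ⟨h2 hx.1, hx.2⟩
  · rintro ⟨c, S⟩ h
    simp only [Finset.mem_sigma, Finset.mem_erase, Finset.mem_powerset, Finset.mem_filter,
      mem_blk] at h ⊢
    obtain ⟨⟨⟨h1, h2, h3⟩, h4⟩, h5⟩ := h
    refine ⟨⟨by simp, ?_⟩, ⟨by simp, by simp, h3⟩, h4⟩
    intro x hx
    simp only [Finset.mem_insert] at hx
    rcases hx with rfl | rfl | hx
    · exact h1
    · exact h2
    · exact (mem_rm.1 (h5 hx)).1
  · rintro ⟨S, c⟩ h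
    simp only [Finset.mem_sigma, Finset.mem_erase, Finset.mem_powerset, Finset.mem_filter,
      mem_blk] at h
    obtain ⟨⟨h1, h2⟩, ⟨h3, h4, h5⟩, h6⟩ := h
    simp only [Sigma.mk.injEq, heq_eq_eq, and_true]
    ext x
    simp only [Finset.mem_insert, mem_rm]
    constructor
    · rintro (rfl | rfl | h)
      exacts [h3, h4, h.1]
    · intro hx; tauto
  · rintro ⟨c, S⟩ h
    simp only [Finset.mem_sigma, Finset.mem_powerset, Finset.mem_filter] at h
    simp only [Sigma.mk.injEq, heq_eq_eq, true_and]
    ext x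
    simp only [Finset.mem_insert, mem_rm]
    constructor
    · tauto
    · intro hx
      have := mem_rm.1 (h.2 hx)
      tauto
  · rintro ⟨S, c⟩ h
    simp only [Finset.mem_sigma, Finset.mem_erase, Finset.mem_powerset, Finset.mem_filter,
      mem_blk] at h
    obtain ⟨⟨h1, h2⟩, ⟨h3, h4, h5⟩, h6⟩ := h
    have : rm V c \ rm S c = V \ S := by
      ext x
      simp only [Finset.mem_sdiff, mem_rm]
      constructor
      · tauto
      · rintro ⟨hx, hx'⟩
        refine ⟨⟨hx, ?_, ?_⟩, by tauto⟩
        · rintro rfl; exact hx' h3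
        · rintro rfl; exact hx' h4
    simp only [this]; ring

lemma conv_eq (n : ℕ) : ∀ (V : Finset ℕ) (b : ℕ × ℕ), V.card = n →
    ∑ S ∈ V.powerset, E b S * P (V \ S) = Q b V := by
  classical
  induction n using Nat.strong_induction_on with
  | _ n ih =>
    intro V b hn
    by_cases hV : V = ∅
    · subst hV; simp [E, Q, cs_empty, P]
    rw [sum_powerset_first]
    have h1 : ∀ b' ∈ (blk V).filter (G b),
        -X * ∑ S ∈ (rm V b').powerset, E b' S * P (rm V b' \ S) = -X * Q b' (rm V b') := by
      intro b' hb'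
      rw [ih _ (hn ▸ rm_card_lt (Finset.mem_filter.1 hb').1) _ _ rfl]
    rw [Finset.sum_congr rfl h1, P, if_neg hV, Q, cs_eq _ _ _ hV,
      ← Finset.sum_filter_add_sum_filter_not (blk V) (G b)]
    simp only [neg_mul, Finset.sum_neg_distrib]
    ring

lemma E_zero (n : ℕ) : ∀ (V : Finset ℕ) (b : ℕ × ℕ) (m : ℕ), V.card = n → m ∈ V → m < b.1 →
    b.1 ≤ b.2 → E b V = 0 := by
  classical
  induction n using Nat.strong_induction_on with
  | _ n ih =>
    intro V b m hn hm hb hbb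
    rw [E, cs_eq _ _ _ (Finset.ne_empty_of_mem hm)]
    apply Finset.sum_eq_zero
    intro b' hb'
    obtain ⟨h1, h2⟩ := Finset.mem_filter.1 hb'
    have h3 := mem_blk.1 h1
    have h4 : b.1 < b'.1 := by rcases h2 with h | h <;> omega
    have := ih _ (hn ▸ rm_card_lt h1) (rm V b') b' m rfl
      (mem_rm.2 ⟨hm, by omega, by omega⟩) (by omega) h3.2.2
    simp only [E] at this
    rw [this, mul_zero]

lemma sum_rank (T : Finset ℕ) (f : ℕ → ℕ → ℚ[X]) :
    ∑ d ∈ T, f (T.filter (· < d)).card (T.filter (d < ·)).card =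
      ∑ i ∈ Finset.range T.card, f i (T.card - 1 - i) := by
  induction T using Finset.induction_on_max generalizing f with
  | empty => simp
  | insert a s ha ih =>
    have has : a ∉ s := fun h => lt_irrefl _ (ha a h)
    rw [Finset.sum_insert has, Finset.card_insert_of_notMem has, Finset.sum_range_succ, add_comm]
    congr 1
    · have := ih (fun i j => f i (j + 1))
      calc _ = ∑ d ∈ s, f (s.filter (· < d)).card ((s.filter (d < ·)).card + 1) := by
            apply Finset.sum_congr rfl
            intro d hd
            have hda := ha d hd
            rw [Finset.filter_insert, if_neg (by omega), Finset.filter_insert, if_pos hda,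
              Finset.card_insert_of_notMem (by simp [has])]
        _ = _ := by
            rw [this]
            apply Finset.sum_congr rfl
            intro i hi
            have := Finset.mem_range.1 hi
            congr 1
            omega
    · have h1 : ((insert a s).filter (· < a)) = s := by
        rw [Finset.filter_insert, if_neg (by omega), Finset.filter_true_of_mem ha]
      have h2 : ((insert a s).filter (a < ·)) = ∅ := by
        rw [Finset.filter_insert, if_neg (by omega), Finset.filter_false_of_mem]
        intro x hx; have := ha x hx; omega
      rw [h1, h2]; simp

end BR

namespace BR

lemma E_eval (n : ℕ) : ∀ (V : Finset ℕ) (b : ℕ × ℕ), V.card = n → (∀ v ∈ V, b.1 < v) →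
    b.1 ≤ b.2 → b.2 ∉ V →
    E b V = e (V.filter (· < b.2)).card (V.filter (b.2 < ·)).card := by
  classical
  induction n using Nat.strong_induction_on with
  | _ n ih =>
    intro V b hn hb hbb hbV
    by_cases hV : V = ∅
    · subst hV; simp [E, cs_empty, e]
    have hVn : V.Nonempty := Finset.nonempty_iff_ne_empty.2 hV
    obtain ⟨m, hmV, hmin⟩ : ∃ m ∈ V, ∀ v ∈ V, m ≤ v :=
      ⟨V.min' hVn, V.min'_mem hVn, fun v hv => V.min'_le v hv⟩
    have step1 : E b V = ∑ c ∈ V.filter (fun c => G b (m, c)),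
        -X * E (m, c) (rm V (m, c)) := by
      rw [E, cs_eq _ _ _ hV, ← Finset.sum_image (f := fun b' => -X * cs (-X) G b' (rm V b'))
        (g := fun c => (m, c))]
      · symm
        apply Finset.sum_subset
        · intro b' hb'
          simp only [Finset.mem_image, Finset.mem_filter] at hb' ⊢
          obtain ⟨c, ⟨h1, h2⟩, rfl⟩ := hb'
          exact ⟨mem_blk.2 ⟨hmV, h1, hmin _ h1⟩, h2⟩
        · rintro ⟨a, c⟩ hb' hnb
          simp only [Finset.mem_image, Finset.mem_filter, mem_blk] at hb' hnb
          have ham : a ≠ m := by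
            rintro rfl
            exact hnb ⟨c, ⟨hb'.1.2.1, hb'.2⟩, rfl⟩
          have h1 := hmin a hb'.1.1
          have h2 := hb'.1.2.2
          have := E_zero _ (rm V (a, c)) (a, c) m rfl
            (mem_rm.2 ⟨hmV, by simp only [ne_eq]; omega, by simp only [ne_eq]; omega⟩)
            (by simp only; omega) h2
          simp only [E] at this
          rw [this, mul_zero]
      · intro x _ y _ h
        simpa using h
    rw [step1]
    set T := V.erase m with hT
    have hmT : m ∉ T := by simp [hT]
    have hVT : V = insert m T := by rw [hT, Finset.insert_erase hmV]
    have hTgt : ∀ v ∈ T, m < v := by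
      intro v hv
      have h1 := Finset.mem_erase.1 hv
      have h2 := hmin v h1.2
      omega
    have step2 : ∀ c ∈ T, E (m, c) (rm V (m, c)) =
        e (T.filter (· < c)).card (T.filter (c < ·)).card := by
      intro c hc
      have hcV : c ∈ V := Finset.mem_of_mem_erase hc
      have hlt := rm_card_lt (mem_blk.2 ⟨hmV, hcV, (hTgt c hc).le⟩ : (m, c) ∈ blk V)
      rw [ih _ (hn ▸ hlt) _ _ rfl]
      · congr 2
        · ext x; simp only [Finset.mem_filter, mem_rm, hT, Finset.mem_erase]
          constructor
          · tauto
          · rintro ⟨⟨h1, h2⟩, h3⟩; exact ⟨⟨h2, h1, by omega⟩, h3⟩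
        · ext x; simp only [Finset.mem_filter, mem_rm, hT, Finset.mem_erase]
          constructor
          · tauto
          · rintro ⟨⟨h1, h2⟩, h3⟩; exact ⟨⟨h2, h1, by omega⟩, h3⟩
      · intro v hv
        have := mem_rm.1 hv
        exact hTgt v (Finset.mem_erase.2 ⟨this.2.1, this.1⟩)
      · exact (hTgt c hc).le
      · simp [mem_rm]
    have hbm : b.2 ≠ m := fun h => hbV (h ▸ hmV)
    rcases lt_or_gt_of_ne hbm with h | h
    · have hf : V.filter (fun c => G b (m, c)) = V :=
        Finset.filter_true_of_mem (fun c _ => Or.inl h)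
      have hf1 : V.filter (· < b.2) = ∅ := by
        apply Finset.filter_false_of_mem
        intro v hv; have := hmin v hv; omega
      have hf2 : V.filter (b.2 < ·) = V := by
        apply Finset.filter_true_of_mem
        intro v hv; have := hmin v hv; omega
      rw [hf, hf1, hf2]
      have hm1 : E (m, m) (rm V (m, m)) = e 0 T.card := by
        have hrm : rm V (m, m) = T := by simp [rm, hT]
        have hlt := rm_card_lt (mem_blk.2 ⟨hmV, hmV, le_rfl⟩ : (m, m) ∈ blk V)
        rw [hrm] at hlt ⊢
        rw [ih _ (hn ▸ hlt) _ _ rfl hTgt le_rfl hmT]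
        have hf1 : T.filter (· < m) = ∅ := by
          apply Finset.filter_false_of_mem
          intro v hv; have := hTgt v hv; omega
        have hf2 : T.filter (m < ·) = T := Finset.filter_true_of_mem hTgt
        simp only [hf1, hf2, Finset.card_empty]
      have hc : V.card = T.card + 1 := by rw [hVT, Finset.card_insert_of_notMem hmT]
      have hsum : ∑ c ∈ V, -X * E (m, c) (rm V (m, c)) =
          -X * E (m, m) (rm V (m, m)) + ∑ c ∈ T, -X * E (m, c) (rm V (m, c)) := by
        rw [hT, Finset.add_sum_erase V (fun c => -X * E (m, c) (rm V (m, c))) hmV]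
      rw [hsum, hm1, hc, Finset.card_empty, e, e_sum, ← sum_rank T (fun i j => -X * e (0 + i) j)]
      congr 1
      apply Finset.sum_congr rfl
      intro c hc
      rw [step2 c hc, zero_add]
    · set D := V.filter (b.2 < ·) with hD
      have hf : V.filter (fun c => G b (m, c)) = D := by
        apply Finset.filter_congr
        intro c hc
        have := hb m hmV
        simp only [G]
        constructor
        · rintro (h1 | h1) <;> omega
        · intro h1; right; omega
      have hp : (V.filter (· < b.2)).card = (T.filter (· < b.2)).card + 1 := by
        rw [hVT, Finset.filter_insert, if_pos h, Finset.card_insert_of_notMem (by simp [hmT])]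
      rw [hf, hp, e_sum, ← sum_rank D (fun i j => -X * e (_ + i) j)]
      apply Finset.sum_congr rfl
      intro c hc
      have hc1 := Finset.mem_filter.1 hc
      have hcT : c ∈ T := Finset.mem_erase.2 ⟨by omega, hc1.1⟩
      rw [step2 c hcT]
      congr 2
      · rw [← Finset.card_union_of_disjoint]
        · congr 1
          ext x
          simp only [Finset.mem_filter, Finset.mem_union, hD, hT, Finset.mem_erase]
          have hx : x ∈ V → x ≠ b.2 := fun h h' => hbV (h' ▸ h)
          constructor
          · rintro ⟨⟨h1, h2⟩, h3⟩
            have := hx h2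
            by_cases h4 : x < b.2
            · left; exact ⟨⟨h1, h2⟩, h4⟩
            · right; exact ⟨⟨h2, by omega⟩, h3⟩
          · rintro (⟨⟨h1, h2⟩, h3⟩ | ⟨⟨h1, h2⟩, h3⟩)
            · exact ⟨⟨h1, h2⟩, by omega⟩
            · exact ⟨⟨by omega, h1⟩, h3⟩
        · rw [Finset.disjoint_left]
          intro x hx hx'
          simp only [Finset.mem_filter, hD] at hx hx'
          omega
      · congr 1
        ext x
        simp only [Finset.mem_filter, hD, hT, Finset.mem_erase]
        constructor
        · rintro ⟨⟨h1, h2⟩, h3⟩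
          exact ⟨⟨h2, by omega⟩, h3⟩
        · rintro ⟨⟨h1, h2⟩, h3⟩
          exact ⟨⟨by omega, h1⟩, h3⟩

lemma conv0 (V : Finset ℕ) (h0 : 0 ∉ V) :
    ∑ S ∈ V.powerset, e 0 S.card * P (V \ S) = if V = ∅ then 1 else 0 := by
  classical
  have h := conv_eq _ V (0, 0) rfl
  have hQ : Q (0, 0) V = if V = ∅ then 1 else 0 := by
    split_ifs with hV
    · subst hV; rw [Q, cs_empty]
    · rw [Q, cs_eq _ _ _ hV]
      apply Finset.sum_eq_zero
      intro b' hb'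
      obtain ⟨h1, h2⟩ := Finset.mem_filter.1 hb'
      exfalso
      apply h2
      left
      have : b'.1 ≠ 0 := fun h => h0 (h ▸ (mem_blk.1 h1).1)
      simp only; omega
  rw [← hQ, ← h]
  apply Finset.sum_congr rfl
  intro S hS
  have hS' := Finset.mem_powerset.1 hS
  have hpos : ∀ v ∈ S, 0 < v := fun v hv => Nat.pos_of_ne_zero (fun h => h0 (h ▸ hS' hv))
  rw [E_eval _ S (0, 0) rfl hpos le_rfl (fun h => h0 (hS' h))]
  simp only [Nat.not_lt_zero, Finset.filter_false, Finset.card_empty,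
    Finset.filter_true_of_mem hpos]

noncomputable def Pn (n : ℕ) : ℚ[X] := P (Finset.Icc 1 n)

lemma P_card (n : ℕ) : ∀ V : Finset ℕ, 0 ∉ V → V.card = n → P V = Pn n := by
  induction n using Nat.strong_induction_on with
  | _ n ih =>
    have key : ∀ V : Finset ℕ, 0 ∉ V → V.card = n →
        P V = (if n = 0 then 1 else 0) -
          ∑ k ∈ Finset.range (n + 1), n.choose k • (if k = 0 then 0 else e 0 k * Pn (n - k)) := by
      intro V h0 hn
      have h := conv0 V h0
      have h2 := Finset.sum_powerset_apply_card
        (fun k => if k = 0 then (0 : ℚ[X]) else e 0 k * Pn (n - k)) (x := V)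
      rw [hn] at h2
      rw [← h2, eq_sub_iff_add_eq]
      have h3 : (if n = 0 then (1 : ℚ[X]) else 0) = if V = ∅ then 1 else 0 := by
        congr 1
        rw [← hn, Finset.card_eq_zero]
      rw [h3, ← h, ← Finset.add_sum_erase _ _ (Finset.empty_mem_powerset V),
        ← Finset.add_sum_erase V.powerset (fun S => e 0 S.card * P (V \ S))
          (Finset.empty_mem_powerset V)]
      simp only [Finset.card_empty, if_true, zero_add, Finset.sdiff_empty, e, one_mul]
      congr 1
      apply Finset.sum_congr rfl
      intro S hS
      obtain ⟨hS1, hS2⟩ := Finset.mem_erase.1 hS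
      have hS3 := Finset.mem_powerset.1 hS2
      have hS4 : 0 < S.card := Finset.card_pos.2 (Finset.nonempty_iff_ne_empty.2 hS1)
      have hS5 := Finset.card_le_card hS3
      rw [if_neg (by omega), ih (n - S.card) (by omega) (V \ S)
        (fun h => h0 (Finset.mem_sdiff.1 h).1) (by rw [Finset.card_sdiff_of_subset hS3, hn])]
    intro V h0 hn
    rw [key V h0 hn, Pn, key (Finset.Icc 1 n) (by simp) (by simp)]

lemma Pn_conv (n : ℕ) (hn : 1 ≤ n) :
    ∑ k ∈ Finset.range (n + 1), n.choose k • (e 0 k * Pn (n - k)) = 0 := by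
  have h := conv0 (Finset.Icc 1 n) (by simp)
  rw [if_neg (by rw [← Finset.card_eq_zero]; simp; omega)] at h
  have h2 := Finset.sum_powerset_apply_card
    (fun k => e 0 k * Pn (n - k)) (x := Finset.Icc 1 n)
  simp only [Nat.card_Icc, Nat.add_sub_cancel] at h2
  rw [← h2, ← h]
  apply Finset.sum_congr rfl
  intro S hS
  have hS3 := Finset.mem_powerset.1 hS
  rw [P_card (n - S.card) _ (fun h => by simp at h) 
    (by rw [Finset.card_sdiff_of_subset hS3]; simp)]

end BR

namespace BR

open scoped Classical in
noncomputable def val : ℕ × ℕ → List ℕ → ℚ[X]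
  | _, [] => 1
  | b, [x] => if x < b.2 then X else 0
  | b, x :: x' :: t => if x < b.2 then
      (if x' < x then X * val (x, x) (x' :: t) else
        if G b (x, x') then 0 else X * val (x, x') t) else 0
termination_by _ l => l.length

noncomputable def pl (V : Finset ℕ) : Finset (List ℕ) := V.toList.permutations.toFinset

lemma mem_pl {V l} : l ∈ pl V ↔ l.Nodup ∧ ∀ x, x ∈ l ↔ x ∈ V := by
  simp only [pl, List.mem_toFinset, List.mem_permutations]
  constructor
  · intro h
    exact ⟨h.nodup_iff.2 V.nodup_toList, fun x => by rw [h.mem_iff, Finset.mem_toList]⟩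
  · rintro ⟨h1, h2⟩
    rw [List.perm_ext_iff_of_nodup h1 V.nodup_toList]
    intro x; rw [h2, Finset.mem_toList]

lemma pl_empty : pl ∅ = {[]} := by
  ext l
  rw [mem_pl]
  simp only [Finset.notMem_empty, iff_false, Finset.mem_singleton]
  constructor
  · rintro ⟨_, h⟩; exact List.eq_nil_iff_forall_not_mem.2 h
  · rintro rfl; simp

lemma sum_pl {V : Finset ℕ} (hV : V ≠ ∅) (f : List ℕ → ℚ[X]) :
    ∑ l ∈ pl V, f l = ∑ a ∈ V, ∑ l ∈ pl (V.erase a), f (a :: l) := by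
  rw [Finset.sum_sigma']
  symm
  refine Finset.sum_bij (fun x _ => x.1 :: x.2) ?_ ?_ ?_ ?_
  · rintro ⟨a, l⟩ h
    simp only [Finset.mem_sigma, mem_pl, Finset.mem_erase] at h ⊢
    obtain ⟨h1, h2, h3⟩ := h
    refine ⟨List.nodup_cons.2 ⟨?_, h2⟩, ?_⟩
    · rw [h3]; simp
    · intro x
      rw [List.mem_cons, h3]
      constructor
      · rintro (rfl | h)
        exacts [h1, h.2]
      · tauto
  · rintro ⟨a, l⟩ _ ⟨a', l'⟩ _ h
    simp only [List.cons.injEq] at h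
    obtain ⟨rfl, rfl⟩ := h
    rfl
  · intro l hl
    rw [mem_pl] at hl
    cases l with
    | nil =>
      exfalso; apply hV
      apply Finset.eq_empty_of_forall_notMem
      intro x hx
      have := (hl.2 x).2 hx
      simp at this
    | cons a t =>
      obtain ⟨h1, h2⟩ := hl
      rw [List.nodup_cons] at h1
      refine ⟨⟨a, t⟩, ?_, rfl⟩
      simp only [Finset.mem_sigma, mem_pl, Finset.mem_erase]
      refine ⟨(h2 a).1 (by simp), h1.2, ?_⟩
      intro x
      rw [← h2 x, List.mem_cons]
      constructor
      · intro h
        exact ⟨fun h' => h1.1 (h' ▸ h), Or.inr h⟩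
      · tauto
  · intros; rfl

open scoped Classical in
noncomputable def val2 (b : ℕ × ℕ) (a : ℕ) : List ℕ → ℚ[X]
  | [] => 0
  | x' :: t => if a < x' then (if G b (a, x') then 0 else X * val (a, x') t) else 0

lemma val_zero (b : ℕ × ℕ) (a : ℕ) (t : List ℕ) (h : ¬ a < b.2) : val b (a :: t) = 0 := by
  cases t <;> simp [val, h]

lemma val_split (b : ℕ × ℕ) (a : ℕ) (l : List ℕ) (h : a < b.2) (ha : a ∉ l) :
    val b (a :: l) = X * val (a, a) l + val2 b a l := by
  cases l with
  | nil => simp [val, val2, h]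
  | cons x t =>
    simp only [List.mem_cons, not_or] at ha
    rw [val, if_pos h, val2]
    by_cases hx : x < a
    · rw [if_pos hx, if_neg (by omega), add_zero]
    · have hax : a < x := by omega
      rw [if_neg hx, if_pos hax, val_zero _ _ _ hx, mul_zero, zero_add]

lemma sum_blk (V : Finset ℕ) (f : ℕ × ℕ → ℚ[X]) :
    ∑ b ∈ blk V, f b = ∑ a ∈ V, (f (a, a) + ∑ c ∈ V.erase a, if a < c then f (a, c) else 0) := by
  rw [blk, Finset.sum_filter, Finset.sum_product]
  apply Finset.sum_congr rfl
  intro a ha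
  rw [← Finset.add_sum_erase _ _ ha]
  simp only [le_refl, if_true]
  congr 1
  apply Finset.sum_congr rfl
  intro c hc
  have := (Finset.mem_erase.1 hc).1
  congr 1
  rw [eq_iff_iff]
  omega

lemma Q_eq (n : ℕ) : ∀ (V : Finset ℕ) (b : ℕ × ℕ), V.card = n → b.2 ∉ V →
    Q b V = ∑ l ∈ pl V, val b l := by
  classical
  induction n using Nat.strong_induction_on with
  | _ n ih =>
    intro V b hn hbV
    by_cases hV : V = ∅
    · subst hV; rw [pl_empty]; simp [Q, cs_empty, val]
    rw [Q, cs_eq _ _ _ hV, sum_pl hV, Finset.sum_filter, sum_blk]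
    apply Finset.sum_congr rfl
    intro a ha
    by_cases hab : a < b.2
    swap
    · have hne : a ≠ b.2 := fun h => hbV (h ▸ ha)
      have hG : ∀ c, G b (a, c) := fun c => Or.inl (by simp only; omega)
      rw [Finset.sum_eq_zero (s := pl (V.erase a)) (fun l _ => val_zero b a l hab)]
      simp [hG]
    · have hsp : ∀ l ∈ pl (V.erase a), val b (a :: l) = X * val (a, a) l + val2 b a l := by
        intro l hl
        apply val_split _ _ _ hab
        rw [(mem_pl.1 hl).2]; simp
      rw [Finset.sum_congr rfl hsp, Finset.sum_add_distrib]
      have hnG : ¬ G b (a, a) := by simp only [G]; omega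
      congr 1
      · rw [if_pos hnG, ← Finset.mul_sum]
        have hlt := rm_card_lt (mem_blk.2 ⟨ha, ha, le_rfl⟩ : (a, a) ∈ blk V)
        have hrm : rm V (a, a) = V.erase a := by simp [rm]
        have := ih _ (hn ▸ hlt) (rm V (a, a)) (a, a) rfl (by simp [mem_rm])
        simp only [Q] at this
        rw [this, hrm]
      · by_cases hW : V.erase a = ∅
        · rw [hW, pl_empty]; simp [val2]
        rw [sum_pl hW]
        apply Finset.sum_congr rfl
        intro c hc
        have hcV := (Finset.mem_erase.1 hc).2
        by_cases hac : a < c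
        · by_cases hG : G b (a, c)
          · simp [val2, hG]
          · simp only [val2, hac, hG, if_true, if_false, not_false_eq_true]
            rw [← Finset.mul_sum]
            have hlt := rm_card_lt (mem_blk.2 ⟨ha, hcV, hac.le⟩ : (a, c) ∈ blk V)
            have := ih _ (hn ▸ hlt) (rm V (a, c)) (a, c) rfl (by simp [mem_rm])
            simp only [Q] at this
            rw [this, rm]
        · simp [val2, hac]

lemma P_eq (V : Finset ℕ) (M : ℕ) (hM : ∀ v ∈ V, v < M) :
    P V = ∑ l ∈ pl V, val (M, M) l := by
  classical
  rw [← Q_eq _ V (M, M) rfl (fun h => lt_irrefl _ (hM _ h))]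
  by_cases hV : V = ∅
  · subst hV; rw [P, if_pos rfl, Q, cs_empty]
  rw [P, if_neg hV, Q, cs_eq _ _ _ hV, Finset.filter_true_of_mem]
  intro b' hb'
  have h := mem_blk.1 hb'
  have := hM _ h.1
  simp only [G]; omega

/-- prefix match -/
def pm : List ℕ → Prop
  | x :: y :: z :: w :: _ => (x < y ∧ y < z) ∨ (x < z ∧ z < y ∧ y < w)
  | [x, y, z] => x < y ∧ y < z
  | _ => False

def ok : List ℕ → Prop
  | [] => True
  | x :: t => ¬ pm (x :: t) ∧ ok t

lemma red3 (x y z : ℕ) : redL [x, y, z] = [1, 2, 3] ↔ x < y ∧ y < z := by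
  simp only [redL, List.map_cons, List.map_nil, List.countP_cons, List.countP_nil,
    List.cons.injEq, decide_eq_true_eq]
  constructor
  · rintro ⟨h1, h2, h3, _⟩
    grind
  · rintro ⟨h1, h2⟩
    grind

lemma red4 (x y z w : ℕ) : redL [x, y, z, w] = [1, 3, 2, 4] ↔ x < z ∧ z < y ∧ y < w := by
  simp only [redL, List.map_cons, List.map_nil, List.countP_cons, List.countP_nil,
    List.cons.injEq, decide_eq_true_eq]
  constructor
  · rintro ⟨h1, h2, h3, h4, _⟩
    grind
  · rintro ⟨h1, h2, h3⟩
    grind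

lemma redL_length (l : List ℕ) : (redL l).length = l.length := by simp [redL]

lemma pm_iff (l : List ℕ) : (∃ j, 1 ≤ j ∧ j + 1 ≤ l.length ∧
    redL (l.take (j + 1)) ∈ ({[1, 3, 2, 4], [1, 2, 3]} : Set (List ℕ))) ↔ pm l := by
  have key : ∀ j, j + 1 ≤ l.length →
      redL (l.take (j + 1)) ∈ ({[1, 3, 2, 4], [1, 2, 3]} : Set (List ℕ)) → j = 2 ∨ j = 3 := by
    intro j hj h
    simp only [Set.mem_insert_iff, Set.mem_singleton_iff] at h
    rcases h with h | h <;>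
    · have h' := congrArg List.length h
      rw [redL_length, List.length_take] at h'
      simp at h'
      omega
  constructor
  · rintro ⟨j, hj, hl, h⟩
    rcases key j hl h with rfl | rfl
    · match l, hl, h with
      | [x, y, z], _, h =>
        simp only [List.take, Set.mem_insert_iff, Set.mem_singleton_iff, red3] at h
        rcases h with h | h
        · have := congrArg List.length h; simp [redL] at this
        · exact h
      | x :: y :: z :: w :: t, _, h =>
        simp only [List.take, Set.mem_insert_iff, Set.mem_singleton_iff, red3] at h
        rcases h with h | h
        · have := congrArg List.length h; simp [redL] at this
        · exact Or.inl h
    · match l, hl, h with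
      | x :: y :: z :: w :: t, _, h =>
        simp only [List.take, Set.mem_insert_iff, Set.mem_singleton_iff, red4] at h
        rcases h with h | h
        · exact Or.inr h
        · have := congrArg List.length h; simp [redL] at this
  · intro h
    match l, h with
    | [x, y, z], h => exact ⟨2, by simp, by simp, Or.inr ((red3 x y z).2 h)⟩
    | x :: y :: z :: w :: t, h =>
      rcases h with h | h
      · exact ⟨2, by simp, by simp, Or.inr ((red3 x y z).2 h)⟩
      · exact ⟨3, by simp, by simp, Or.inl ((red4 x y z w).2 h)⟩

lemma hasMatch_iff (l : List ℕ) : ¬ HasMatch {[1, 3, 2, 4], [1, 2, 3]} l ↔ ok l := by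
  induction l with
  | nil => simp [HasMatch, ok]
  | cons x t ih =>
    rw [ok, ← ih, ← pm_iff, ← not_or, not_iff_not]
    constructor
    · rintro ⟨i, j, h1, h2, h3⟩
      cases i with
      | zero => left; exact ⟨j, h1, by simpa using h2, by simpa using h3⟩
      | succ i => right; exact ⟨i, j, h1, by simp at h2; omega, by simpa using h3⟩
    · rintro (⟨j, h1, h2, h3⟩ | ⟨i, j, h1, h2, h3⟩)
      · exact ⟨0, j, h1, by simpa using h2, by simpa using h3⟩
      · exact ⟨i + 1, j, h1, by simp; omega, by simpa using h3⟩

def runs : List ℕ → ℕ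
  | [] => 0
  | x :: t => 1 + desL (x :: t)

lemma runs_cons (x y : ℕ) (t : List ℕ) :
    runs (x :: y :: t) = runs (y :: t) + if y < x then 1 else 0 := by
  simp [runs, desL, List.countP_cons]
  ring

def pre (b : ℕ × ℕ) : List ℕ := if b.1 = b.2 then [b.1] else [b.1, b.2]

def hd (c : ℕ) : List ℕ → Prop
  | [] => True
  | x :: _ => x < c

open scoped Classical in
lemma val_eq (n : ℕ) : ∀ (l : List ℕ) (b : ℕ × ℕ), l.length = n → l.Nodup → b.1 ≤ b.2 →
    val b l = if hd b.2 l ∧ ok (pre b ++ l) then X ^ runs l else 0 := by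
  induction n using Nat.strong_induction_on with
  | _ n ih =>
    rintro l ⟨a, c⟩ hl hnd hb
    simp only at hb
    match l, hl, hnd with
    | [], _, _ =>
      rw [val, if_pos]
      · simp [runs]
      · simp only [hd, true_and, pre]
        split_ifs <;> simp [ok, pm]
    | [x], _, _ =>
      rw [val]
      by_cases hx : x < c
      · rw [if_pos hx, if_pos]
        · simp [runs, desL]
        · refine ⟨hx, ?_⟩
          simp only [pre]
          split_ifs
          · simp [ok, pm]
          · simp [ok, pm]; omega
      · rw [if_neg hx, if_neg]
        rintro ⟨h, -⟩; exact hx h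
    | x :: x' :: t, hl, hnd =>
      rw [val]
      by_cases hx : x < c
      swap
      · rw [if_neg hx, if_neg]
        rintro ⟨h, -⟩; exact hx h
      rw [if_pos hx]
      simp only [List.length_cons] at hl
      have hnd2 : (x' :: t).Nodup := (List.nodup_cons.1 hnd).2
      have hnd3 : t.Nodup := (List.nodup_cons.1 hnd2).2
      have hne : x ≠ x' := by
        rintro rfl
        exact (List.nodup_cons.1 hnd).1 (by simp)
      have hc1 : ¬ pm (c :: x :: x' :: t) := by
        cases t <;> simp only [pm] <;> omega
      have hd1 : hd c (x :: x' :: t) := hx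
      by_cases hxx : x' < x
      · rw [if_pos hxx, ih (t.length + 1) (by omega) (x' :: t) (x, x) rfl hnd2 le_rfl]
        have e1 : ok (pre (a, c) ++ x :: x' :: t) ↔ ok (x :: x' :: t) := by
          simp only [pre]
          split_ifs with hac
          · simp only [List.cons_append, List.nil_append, ok]
            rw [hac]; tauto
          · have : ¬ pm (a :: c :: x :: x' :: t) := by simp only [pm]; omega
            simp only [List.cons_append, List.nil_append, ok]
            tauto
        have e2 : hd x (x' :: t) := hxx
        simp only [hd1, e1, e2, true_and]
        have e3 : pre (x, x) ++ x' :: t = x :: x' :: t := by simp [pre]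
        rw [e3, runs_cons, if_pos hxx]
        split_ifs
        · ring
        · simp
      · rw [if_neg hxx, ih t.length (by omega) t (x, x') rfl hnd3 (by simp only; omega)]
        have e3 : pre (x, x') ++ t = x :: x' :: t := by simp [pre, hne]
        have e1 : ok (pre (a, c) ++ x :: x' :: t) ↔ ¬ G (a, c) (x, x') ∧ ok (x :: x' :: t) := by
          simp only [pre, G]
          split_ifs with hac
          · simp only [List.cons_append, List.nil_append]
            rw [ok]
            have : ¬ (c < x ∨ a < x ∧ x < c ∧ c < x') := by omega
            rw [hac]
            tauto
          · have : pm (a :: c :: x :: x' :: t) ↔ (c < x ∨ a < x ∧ x < c ∧ c < x') := by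
              simp only [pm]; omega
            simp only [List.cons_append, List.nil_append]
            rw [ok, ok, this]
            tauto
        have e4 : ok (x :: x' :: t) → hd x' t := by
          cases t with
          | nil => intro _; trivial
          | cons w t =>
            intro h
            have h1 := h.1
            have hne2 : x' ≠ w := by
              rintro rfl
              exact (List.nodup_cons.1 hnd2).1 (by simp)
            simp only [hd]
            cases t <;> simp only [pm] at h1 <;> omega
        rw [e3, e1]
        simp only [hd1, true_and]
        by_cases hG : G (a, c) (x, x')
        · simp [hG]
        · simp only [hG, if_false, not_false_eq_true, true_and]
          by_cases hok : ok (x :: x' :: t)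
          · rw [if_pos ⟨e4 hok, hok⟩, if_pos hok, runs_cons, if_neg hxx]
            have e5 := e4 hok
            cases t with
            | nil => simp [runs, desL]
            | cons w t =>
              simp only [hd] at e5
              rw [runs_cons x' w, if_pos e5]; ring
          · simp [hok]

lemma NM_eq (n : ℕ) : NMpoly {[1, 3, 2, 4], [1, 2, 3]} n = Pn n := by
  classical
  rw [Pn, P_eq (Finset.Icc 1 n) (n + 1) (by intro v hv; have := Finset.mem_Icc.1 hv; omega)]
  by_cases hn : n = 0
  · subst hn
    have : Finset.Icc 1 0 = (∅ : Finset ℕ) := by simp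
    rw [this, pl_empty]
    simp [NMpoly, val]
  rw [NMpoly, if_neg hn, NMfinset, Finset.sum_filter]
  have hpl : (List.range' 1 n).permutations.toFinset = pl (Finset.Icc 1 n) := by
    ext l
    rw [mem_pl, List.mem_toFinset, List.mem_permutations]
    constructor
    · intro h
      refine ⟨h.nodup_iff.2 List.nodup_range', fun x => ?_⟩
      rw [h.mem_iff, List.mem_range'_1, Finset.mem_Icc]; omega
    · rintro ⟨h1, h2⟩
      rw [List.perm_ext_iff_of_nodup h1 List.nodup_range']
      intro x; rw [h2, List.mem_range'_1, Finset.mem_Icc]; omega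
  have hpl' : ∀ f : List ℕ → ℚ[X],
    ∑ l ∈ (List.range' 1 n).permutations.toFinset, f l = ∑ l ∈ pl (Finset.Icc 1 n), f l := by
    intro f; rw [← hpl]
  refine Eq.trans ?_ ((hpl' (fun l => if ok l then X ^ runs l else 0)).trans ?_)
  · apply Finset.sum_congr
    · congr!
    intro l hl
    have hl' : l ≠ [] := by
      rintro rfl
      rw [List.mem_toFinset, List.mem_permutations] at hl
      have := hl.length_eq
      simp at this; omega
    simp only [hasMatch_iff]
    cases l with
    | nil => exact absurd rfl hl'
    | cons x t => simp only [runs]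
  · apply Finset.sum_congr rfl
    intro l hl
    rw [mem_pl] at hl
    rw [val_eq _ l (n + 1, n + 1) rfl hl.1 le_rfl]
    congr 1
    rw [eq_iff_iff]
    have hpre : pre (n + 1, n + 1) ++ l = (n + 1) :: l := by simp [pre]
    rw [hpre, ok]
    have hlt : ∀ x ∈ l, x < n + 1 := by
      intro x hx
      have := Finset.mem_Icc.1 ((hl.2 x).1 hx)
      omega
    have h1 : hd (n + 1) l := by
      cases l with
      | nil => trivial
      | cons x t => exact hlt x (by simp)
    have h2 : ¬ pm ((n + 1) :: l) := by
      match l, hlt with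
      | [], _ => simp [pm]
      | [x], _ => simp [pm]
      | [x, y], h =>
        have := h x (by simp)
        simp only [pm]; omega
      | x :: y :: z :: t, h =>
        have := h x (by simp)
        have := h y (by simp)
        simp only [pm]; omega
    tauto

end BR

theorem stmt9 (Γ : Set (List ℕ)) (hΓ : Γ = {[1, 3, 2, 4], [1, 2, 3]})
    (U : ℤ → Polynomial ℚ)
    (hUneg : ∀ m : ℤ, m < 0 → U m = 0)
    (hU0 : U 0 = 1)
    (hUrec : ∀ n : ℕ, 1 ≤ n →
      ∑ k ∈ Finset.range (n + 1), (n.choose k : ℚ) • (U (k : ℤ) * NMpoly Γ (n - k)) = 0) :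
    ∀ n : ℕ,
      U ((2 * n : ℕ) : ℤ) = ∑ k ∈ Finset.range (n + 1),
        Polynomial.C ((2 * (k : ℚ) + 1) * ((2 * n).choose (n - k) : ℚ) / ((n : ℚ) + k + 1)) *
          (-X : Polynomial ℚ) ^ (n + k) := by
  subst hΓ
  have key : ∀ n : ℕ, U (n : ℤ) = BR.e 0 n := by
    intro n
    induction n using Nat.strong_induction_on with
    | _ n ih =>
      by_cases hn : n = 0
      · subst hn; rw [BR.e]; simpa using hU0
      have h1 := hUrec n (by omega)
      have h2 := BR.Pn_conv n (by omega)
      rw [Finset.sum_range_succ] at h1 h2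
      have h3 : ∑ k ∈ Finset.range n, (n.choose k : ℚ) •
          (U (k : ℤ) * NMpoly {[1, 3, 2, 4], [1, 2, 3]} (n - k)) =
          ∑ k ∈ Finset.range n, n.choose k • (BR.e 0 k * BR.Pn (n - k)) := by
        apply Finset.sum_congr rfl
        intro k hk
        rw [ih k (Finset.mem_range.1 hk), BR.NM_eq, Nat.cast_smul_eq_nsmul]
      have h4 : BR.Pn 0 = 1 := by rw [← BR.NM_eq]; simp [NMpoly]
      rw [h3, ← h2] at h1
      have h5 := add_left_cancel h1
      simpa [BR.NM_eq, h4] using h5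
  intro n
  rw [key, BR.e_final]
end

section
/- Let Γ = {1324, 123}. Then for all n ≥ 0, U_{Γ,2n+1}(y) = Σ_{k=0}^{n} [ 2(k+1)·binom(2n+1, n−k) / (n+k+2) ]·(−y)^{n+k+1}. -/
open Polynomial

/-- Weight of a word avoiding the patterns, computed recursively. -/
noncomputable def ww : List ℕ → ℚ[X]
  | [] => 1
  | [_] => X
  | [a, b] => if a < b then X else X * ww [b]
  | [a, b, c] => if a < b then (if b < c then 0 else X * ww [c]) else X * ww [b, c]
  | a :: b :: c :: d :: l =>
    if a < b then
      (if b < c then 0 else if a < c ∧ b < d then 0 else X * ww (c :: d :: l))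
    else X * ww (b :: c :: d :: l)

/-- The convolution inverse of `ww` on words. -/
noncomputable def uu : List ℕ → ℚ[X]
  | [] => 1
  | [_] => -X
  | [a, b] => if a < b then X ^ 2 - X else 0
  | [a, b, c] => if a < b ∧ b < c then -X * (uu [b, c] + uu [c]) else 0
  | a :: b :: c :: d :: l =>
    if a < b then
      (if b < c then -X * (uu (b :: c :: d :: l) + uu (c :: d :: l))
       else if a < c ∧ b < d then -X * uu (c :: d :: l) - X ^ 2 * uu (d :: l) else 0)
    else 0

/-- Convolution of `f` with `uu` on prefixes and suffixes. -/
noncomputable def cv : (List ℕ → ℚ[X]) → List ℕ → ℚ[X]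
  | f, [] => f [] * uu []
  | f, a :: l => f [] * uu (a :: l) + cv (fun x => f (a :: x)) l

theorem cv_zero (l : List ℕ) : cv (fun _ => 0) l = 0 := by
  induction l with
  | nil => simp [cv]
  | cons a l ih => simp [cv, ih]

theorem cv_smul (p : ℚ[X]) (f : List ℕ → ℚ[X]) (l : List ℕ) :
    cv (fun x => p * f x) l = p * cv f l := by
  induction l generalizing f with
  | nil => simp [cv, mul_assoc]
  | cons a l ih => simp [cv, ih (fun x => f (a :: x)), mul_add, mul_assoc]

theorem uu_desc (a b : ℕ) (l : List ℕ) (h : ¬ a < b) : uu (a :: b :: l) = 0 := by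
  match l with
  | [] => simp [uu, h]
  | [c] => simp [uu, h]
  | c :: d :: l => simp [uu, h]

theorem ww_desc (a b : ℕ) (l : List ℕ) (h : ¬ a < b) : ww (a :: b :: l) = X * ww (b :: l) := by
  match l with
  | [] => simp [ww, h]
  | [c] => simp [ww, h]
  | c :: d :: l => simp [ww, h]

theorem ww_asc_asc (a b c : ℕ) (l : List ℕ) (h : a < b) (h' : b < c) :
    ww (a :: b :: c :: l) = 0 := by
  match l with
  | [] => simp [ww, h, h']
  | d :: l => simp [ww, h, h']

theorem uu_asc_asc (a b c : ℕ) (l : List ℕ) (h : a < b) (h' : b < c) :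
    uu (a :: b :: c :: l) = -X * (uu (b :: c :: l) + uu (c :: l)) := by
  match l with
  | [] => conv_lhs => rw [uu]
          simp only [h, h', and_self, if_true]
  | d :: l => conv_lhs => rw [uu]
              simp only [h, h', if_true]

theorem cv_ww : ∀ (n : ℕ) (l : List ℕ), l.length = n → l ≠ [] → cv ww l = 0 := by
  intro n
  induction n using Nat.strong_induction_on with
  | _ n ih =>
  intro l hl hne
  match l with
  | [] => exact absurd rfl hne
  | [a] => simp [cv, ww, uu]
  | a :: b :: l =>
    by_cases h : a < b
    · match l with
      | [] => simp [cv, ww, uu, h]; ring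
      | c :: l =>
        by_cases h' : b < c
        · simp only [cv, ww_asc_asc a b c _ h h', cv_zero, uu_asc_asc a b c _ h h']
          simp [ww, h]; ring
        · match l with
          | [] =>
            simp [cv, ww, h, h', uu]
          | d :: l =>
            have hcd := ih (c :: d :: l).length (by simp at hl ⊢; omega) (c :: d :: l) rfl (by simp)
            by_cases h'' : a < c ∧ b < d
            · have e : (fun x => ww (a :: b :: c :: d :: x)) = fun _ => 0 := by
                funext x; simp [ww, h, h', h'']
              have e1 : uu (a :: b :: c :: d :: l) =
                -X * uu (c :: d :: l) - X ^ 2 * uu (d :: l) := by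
                  rw [uu]; simp [h, h', h'']
              simp only [cv, e, cv_zero, e1, uu_desc b c _ h']
              simp [ww, h, h']; ring
            · have e : (fun x => ww (a :: b :: c :: d :: x)) = fun x => X * ww (c :: d :: x) := by
                funext x; rw [ww]; simp only [h, h', h'', if_true, if_false]
              have e1 : uu (a :: b :: c :: d :: l) = 0 := by
                  rw [uu]; simp only [h, h', h'', if_true, if_false]
              simp only [cv] at hcd
              simp only [cv, e, cv_smul, e1, uu_desc b c _ h']
              simp only [ww, h, h', if_true, if_false] at hcd ⊢
              linear_combination X * hcd
    · have hb := ih (b :: l).length (by simp at hl ⊢; omega) (b :: l) rfl (by simp)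
      have e : (fun x => ww (a :: b :: x)) = fun x => X * ww (b :: x) := by
        funext x; exact ww_desc a b x h
      simp only [cv] at hb
      simp only [cv, e, cv_smul, uu_desc a b _ h]
      simp only [ww] at hb ⊢
      linear_combination X * hb

theorem uu_min : ∀ (n : ℕ) (a : ℕ) (l : List ℕ), l.length = n → uu (a :: l) ≠ 0 →
    ∀ x ∈ l, a < x := by
  intro n
  induction n using Nat.strong_induction_on with
  | _ n ih =>
  intro a l hl hne
  match l with
  | [] => simp
  | b :: l =>
    by_cases h : a < b
    swap
    · exact absurd (uu_desc a b l h) hne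
    match l with
    | [] => simpa using h
    | c :: l =>
      have ihb := ih (c :: l).length (by simp at hl ⊢; omega) b (c :: l) rfl
      have ihc := ih l.length (by simp at hl ⊢; omega) c l rfl
      by_cases h' : b < c
      · rw [uu_asc_asc a b c l h h'] at hne
        have : uu (b :: c :: l) ≠ 0 ∨ uu (c :: l) ≠ 0 := by
          by_contra hh; push Not at hh; simp [hh.1, hh.2] at hne
        intro x hx
        simp only [List.mem_cons] at hx ihb
        rcases this with h1 | h1
        · rcases hx with rfl | hx
          · exact h
          · exact h.trans (ihb h1 x hx)
        · rcases hx with rfl | rfl | hx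
          · exact h
          · exact h.trans h'
          · exact (h.trans h').trans (ihc h1 x hx)
      · match l with
        | [] => simp [uu, h'] at hne
        | d :: l =>
          have ihd := ih l.length (by simp at hl ⊢; omega) d l rfl
          rw [uu] at hne
          simp only [h, h', if_true, if_false] at hne
          by_cases h'' : a < c ∧ b < d
          · simp only [h'', and_self, if_true] at hne
            have : uu (c :: d :: l) ≠ 0 ∨ uu (d :: l) ≠ 0 := by
              by_contra hh; push Not at hh; simp [hh.1, hh.2] at hne
            intro x hx
            simp only [List.mem_cons] at hx ihc
            rcases this with h1 | h1
            · rcases hx with rfl | rfl | hx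
              · exact h
              · exact h''.1
              · exact h''.1.trans (ihc h1 x hx)
            · rcases hx with rfl | rfl | rfl | hx
              · exact h
              · exact h''.1
              · exact h.trans h''.2
              · exact (h.trans h''.2).trans (ihd h1 x hx)
          · simp [h''] at hne

theorem uu_eq_zero {a x : ℕ} {l : List ℕ} (hx : x ∈ l) (h : x < a) : uu (a :: l) = 0 := by
  by_contra hne
  have := uu_min _ a l rfl hne x hx
  omega

/-- All arrangements of a finite set. -/
noncomputable def LL (s : Finset ℕ) : Finset (List ℕ) := s.toList.permutations.toFinset

theorem mem_LL {s : Finset ℕ} {l : List ℕ} : l ∈ LL s ↔ l.Nodup ∧ l.toFinset = s := by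
  simp only [LL, List.mem_toFinset, List.mem_permutations]
  constructor
  · intro h
    refine ⟨h.nodup_iff.mpr s.nodup_toList, ?_⟩
    ext x; simp [h.mem_iff]
  · rintro ⟨h, rfl⟩
    rw [List.perm_ext_iff_of_nodup h (Finset.nodup_toList _)]
    simp

theorem LL_empty : LL ∅ = {[]} := by
  ext l; rw [mem_LL]; simp only [Finset.mem_singleton, List.toFinset_eq_empty_iff]
  constructor
  · exact fun h => h.2
  · rintro rfl; simp

theorem sum_LL (s : Finset ℕ) (hs : s.Nonempty) (f : List ℕ → ℚ[X]) :
    ∑ l ∈ LL s, f l = ∑ a ∈ s, ∑ l ∈ LL (s.erase a), f (a :: l) := by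
  rw [Finset.sum_sigma']
  symm
  refine Finset.sum_bij (fun p _ => p.1 :: p.2) ?_ ?_ ?_ ?_
  · rintro ⟨a, l⟩ h
    simp only [Finset.mem_sigma, mem_LL] at h ⊢
    obtain ⟨ha, hl, hs⟩ := h
    have : a ∉ l := by rw [← List.mem_toFinset, hs]; simp
    simp [hl, hs, this, ha]
  · rintro ⟨a, l⟩ _ ⟨b, l'⟩ _ h
    simp only [List.cons.injEq] at h
    obtain ⟨rfl, rfl⟩ := h; rfl
  · intro l hl
    rw [mem_LL] at hl
    match l with
    | [] => simp at hl; simp [← hl] at hs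
    | a :: l =>
      refine ⟨⟨a, l⟩, ?_, rfl⟩
      simp only [Finset.mem_sigma, mem_LL]
      obtain ⟨h1, rfl⟩ := hl
      rw [List.nodup_cons] at h1
      refine ⟨by simp, h1.2, ?_⟩
      have : a ∉ l.toFinset := by simpa using h1.1
      simp [this]
  · intro _ _; rfl

theorem sum_cv : ∀ (n : ℕ) (s : Finset ℕ) (f : List ℕ → ℚ[X]), s.card = n →
    ∑ l ∈ LL s, cv f l = ∑ A ∈ s.powerset, (∑ l ∈ LL A, f l) * ∑ l ∈ LL (s \ A), uu l := by
  intro n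
  induction n with
  | zero =>
    intro s f hs
    rw [Finset.card_eq_zero] at hs
    subst hs
    simp [LL_empty, cv]
  | succ n ih =>
    intro s f hs
    have hne : s.Nonempty := by rw [← Finset.card_pos]; omega
    have h1 : ∑ A ∈ s.powerset, (∑ l ∈ LL A, f l) * ∑ l ∈ LL (s \ A), uu l =
      f [] * ∑ l ∈ LL s, uu l + ∑ A ∈ s.powerset, ∑ a ∈ A,
        (∑ l ∈ LL (A.erase a), f (a :: l)) * ∑ l ∈ LL (s \ A), uu l := by
      rw [← Finset.add_sum_erase _ _ (Finset.empty_mem_powerset s),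
        ← Finset.add_sum_erase (s.powerset) (fun A => ∑ a ∈ A,
        (∑ l ∈ LL (A.erase a), f (a :: l)) * ∑ l ∈ LL (s \ A), uu l)
          (Finset.empty_mem_powerset s)]
      simp only [LL_empty, Finset.sum_singleton, Finset.sdiff_empty, Finset.sum_empty, zero_add]
      congr 1
      refine Finset.sum_congr rfl fun A hA => ?_
      rw [sum_LL A (Finset.nonempty_iff_ne_empty.mpr (Finset.ne_of_mem_erase hA)),
        Finset.sum_mul]
    rw [h1, sum_LL s hne, sum_LL s hne uu]
    simp only [cv, Finset.sum_add_distrib, ← Finset.mul_sum]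
    congr 1
    have h2 : ∀ a ∈ s, ∑ l ∈ LL (s.erase a), cv (fun x => f (a :: x)) l =
        ∑ A ∈ (s.erase a).powerset, (∑ l ∈ LL A, f (a :: l)) *
          ∑ l ∈ LL (s.erase a \ A), uu l := by
      intro a ha
      exact ih _ _ (by rw [Finset.card_erase_of_mem ha]; omega)
    rw [Finset.sum_congr rfl h2, Finset.sum_sigma', Finset.sum_sigma']
    refine Finset.sum_bij' (fun p _ => ⟨insert p.1 p.2, p.1⟩) (fun p _ => ⟨p.2, p.1.erase p.2⟩)
      ?_ ?_ ?_ ?_ ?_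
    · rintro ⟨a, A⟩ h
      simp only [Finset.mem_sigma, Finset.mem_powerset] at h ⊢
      refine ⟨Finset.insert_subset h.1 (h.2.trans (Finset.erase_subset _ _)), by simp⟩
    · rintro ⟨A, a⟩ h
      simp only [Finset.mem_sigma, Finset.mem_powerset] at h ⊢
      exact ⟨h.1 h.2, Finset.erase_subset_erase _ h.1⟩
    · rintro ⟨a, A⟩ h
      simp only [Finset.mem_sigma, Finset.mem_powerset] at h ⊢
      have : a ∉ A := fun h' => by simpa using h.2 h'
      simp [this]
    · rintro ⟨A, a⟩ h
      simp only [Finset.mem_sigma, Finset.mem_powerset] at h ⊢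
      simp [h.2]
    · rintro ⟨a, A⟩ h
      simp only [Finset.mem_sigma, Finset.mem_powerset] at h ⊢
      have : a ∉ A := fun h' => by simpa using h.2 h'
      have e : s.erase a \ A = s \ insert a A := by ext x; simp; tauto
      simp [this, e]

theorem red3 (a b c : ℕ) : redL [a, b, c] = [1, 2, 3] ↔ a < b ∧ b < c := by
  simp only [redL, List.map_cons, List.map_nil, List.countP_cons, List.countP_nil, List.cons.injEq,
    decide_eq_true_eq, and_true]
  split_ifs <;> omega

theorem red4 (a b c d : ℕ) : redL [a, b, c, d] = [1, 3, 2, 4] ↔ a < c ∧ c < b ∧ b < d := by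
  simp only [redL, List.map_cons, List.map_nil, List.countP_cons, List.countP_nil, List.cons.injEq,
    decide_eq_true_eq, and_true, lt_irrefl, if_false]
  constructor
  · rintro ⟨h1, h2, h3, h4⟩
    have f1 : ¬ b < a ∧ ¬ c < a ∧ ¬ d < a := by
      clear h2 h3 h4
      split_ifs at h1 <;> omega
    have f2 : a < d ∧ b < d ∧ c < d := by
      clear h1 h2 h3
      split_ifs at h4 <;> omega
    have f3 : a < b ∧ c < b := by
      clear h1 h3 h4
      split_ifs at h2 <;> omega
    clear h1 h2 h4
    split_ifs at h3 <;> omega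
  · rintro ⟨h1, h2, h3⟩
    rw [if_neg (show ¬ b < a by omega), if_neg (show ¬ c < a by omega),
      if_neg (show ¬ d < a by omega), if_pos (show a < b by omega), if_pos h2,
      if_neg (show ¬ d < b by omega), if_pos h1, if_neg (show ¬ b < c by omega),
      if_neg (show ¬ d < c by omega), if_pos (show a < d by omega), if_pos h3,
      if_pos (show c < d by omega)]
    simp

/-- The pattern set. -/
def GG0 : Set (List ℕ) := {[1, 3, 2, 4], [1, 2, 3]}

theorem hasMatch_cons (a : ℕ) (l : List ℕ) : HasMatch GG0 (a :: l) ↔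
    (redL ((a :: l).take 3) = [1, 2, 3] ∨ redL ((a :: l).take 4) = [1, 3, 2, 4]) ∨
      HasMatch GG0 l := by
  constructor
  · rintro ⟨i, j, hj, hij, h⟩
    match i with
    | 0 =>
      left
      have hlen : (redL (((a :: l).drop 0).take (j + 1))).length = j + 1 := by
        simp [redL] at hij ⊢; omega
      simp only [GG0, Set.mem_insert_iff, Set.mem_singleton_iff] at h
      rcases h with h | h
      · right
        rw [h] at hlen
        simp at hlen
        have : j = 3 := by omega
        subst this; simpa using h
      · left
        rw [h] at hlen
        simp at hlen
        have : j = 2 := by omega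
        subst this; simpa using h
    | i + 1 =>
      right
      exact ⟨i, j, hj, by simp at hij; omega, by simpa using h⟩
  · rintro ((h | h) | ⟨i, j, hj, hij, h⟩)
    · refine ⟨0, 2, by norm_num, ?_, ?_⟩
      · have := congrArg List.length h
        simp [redL] at this ⊢; omega
      · simp [GG0]; right; simpa using h
    · refine ⟨0, 3, by norm_num, ?_, ?_⟩
      · have := congrArg List.length h
        simp [redL] at this ⊢; omega
      · simp [GG0]; left; simpa using h
    · exact ⟨i + 1, j, hj, by simp; omega, by simpa using h⟩

theorem hasMatch_nil : ¬ HasMatch GG0 [] := by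
  rintro ⟨i, j, hj, hij, h⟩
  simp at hij

theorem hasMatch_one (a : ℕ) : ¬ HasMatch GG0 [a] := by
  rw [hasMatch_cons]
  simp [hasMatch_nil, redL]

theorem hasMatch_two (a b : ℕ) : ¬ HasMatch GG0 [a, b] := by
  rw [hasMatch_cons]
  simp [hasMatch_one, redL]

theorem hasMatch_three (a b c : ℕ) : HasMatch GG0 [a, b, c] ↔ a < b ∧ b < c := by
  rw [hasMatch_cons]
  simp only [List.take, red3, hasMatch_two, or_false]
  simp [redL]

theorem hasMatch_four (a b c d : ℕ) (l : List ℕ) : HasMatch GG0 (a :: b :: c :: d :: l) ↔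
    (a < b ∧ b < c) ∨ (a < c ∧ c < b ∧ b < d) ∨ HasMatch GG0 (b :: c :: d :: l) := by
  rw [hasMatch_cons]
  simp only [List.take, red3, red4, or_assoc]

theorem hasMatch_desc (a b : ℕ) (l : List ℕ) (h : b < a) :
    HasMatch GG0 (a :: b :: l) ↔ HasMatch GG0 (b :: l) := by
  match l with
  | [] => simp [hasMatch_one, hasMatch_two]
  | [c] => simp only [hasMatch_three, hasMatch_two]; simp; omega
  | c :: d :: l =>
    rw [hasMatch_four]
    constructor
    · rintro (h | h | h)
      · omega
      · omega
      · exact h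
    · intro h; exact Or.inr (Or.inr h)

theorem desL_cons (a b : ℕ) (l : List ℕ) :
    desL (a :: b :: l) = desL (b :: l) + if b < a then 1 else 0 := by
  simp [desL, List.countP_cons]

open scoped Classical in
theorem ww_eq : ∀ (n : ℕ) (l : List ℕ), l.length = n → l.Nodup → l ≠ [] →
    ww l = if HasMatch GG0 l then 0 else X ^ (1 + desL l) := by
  intro n
  induction n using Nat.strong_induction_on with
  | _ n ih =>
  intro l hl hnd hne
  match l with
  | [] => exact absurd rfl hne
  | [a] => simp [ww, hasMatch_one, desL]
  | a :: b :: l =>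
    by_cases h : a < b
    · match l with
      | [] => simp [ww, hasMatch_two, h, desL, h.le]
      | c :: l =>
        have hbc : b ≠ c := by simp at hnd; tauto
        by_cases h' : b < c
        · rw [ww_asc_asc a b c l h h', if_pos]
          match l with
          | [] => rw [hasMatch_three]; exact ⟨h, h'⟩
          | d :: l => rw [hasMatch_four]; left; exact ⟨h, h'⟩
        · have hcb : c < b := by omega
          have hab : ¬ b < a := by omega
          have e := ih (c :: l).length (by simp at hl ⊢; omega) (c :: l) rfl
            (by simp only [List.nodup_cons] at hnd ⊢; tauto) (by simp)
          match l with
          | [] =>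
            simp [ww, hasMatch_three, h, h', desL, hcb, hab]; ring
          | d :: l =>
            rw [ww, hasMatch_four, hasMatch_desc b c _ hcb, desL_cons a b, desL_cons b c]
            simp only [h, h', hcb, hab, if_true, if_false, true_and, and_false, false_or]
            by_cases h'' : a < c ∧ b < d
            · simp [h'']
            · rw [e]
              simp only [h'', if_false, false_or]
              split_ifs
              · simp
              · ring
    · have hab : a ≠ b := by simp at hnd; tauto
      have hba : b < a := by omega
      have e := ih (b :: l).length (by simp at hl ⊢; omega) (b :: l) rfl
            (by simp only [List.nodup_cons] at hnd ⊢; tauto) (by simp)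
      rw [ww_desc a b l h, e, hasMatch_desc a b l hba, desL_cons]
      simp only [hba, if_true]
      split_ifs
      · simp
      · ring

theorem NM_eq (n : ℕ) : NMpoly GG0 n = ∑ l ∈ LL (Finset.Icc 1 n), ww l := by
  rcases Nat.eq_zero_or_pos n with rfl | hn
  · simp [NMpoly, LL_empty, ww]
  · have hLL : (List.range' 1 n).permutations.toFinset = LL (Finset.Icc 1 n) := by
      ext l
      simp only [mem_LL, List.mem_toFinset, List.mem_permutations]
      constructor
      · intro h
        refine ⟨h.nodup_iff.mpr List.nodup_range', ?_⟩
        ext x; simp [h.mem_iff, List.mem_range'_1]; omega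
      · rintro ⟨h, h2⟩
        rw [List.perm_ext_iff_of_nodup h List.nodup_range']
        intro x
        rw [← List.mem_toFinset, h2]
        simp [List.mem_range'_1]; omega
    rw [NMpoly, if_neg (by omega), NMfinset, hLL, Finset.sum_filter]
    refine Finset.sum_congr rfl fun l hl => ?_
    rw [mem_LL] at hl
    rw [ww_eq _ l rfl hl.1]
    · split_ifs <;> simp_all
    · rintro rfl
      have := congrArg Finset.card hl.2
      simp at this; omega

/-- Generating polynomial by up-steps of nonnegative paths with `m` steps starting at height `h`. -/
noncomputable def gg : ℕ → ℕ → ℚ[X]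
  | 0, _ => 1
  | m + 1, 0 => -X * gg m 1
  | m + 1, h + 1 => -X * gg m (h + 2) + gg m h

/-- Closed form for the refined sums. -/
noncomputable def aa (p : ℕ) : ℕ → ℚ[X]
  | 0 => -X * (gg (p + 1) 0 + gg p 0)
  | r + 1 => (-X) ^ (r + 2) * (gg (p - (r + 1)) (r + 1) - gg (p - (r + 1)) r)

theorem sum_aa_tail (q : ℕ) : ∀ (k r : ℕ), r + k = q + 1 → 1 ≤ r →
    ∑ i ∈ Finset.Ico r (q + 1), aa q i =
      (-X) ^ (r + 1) * (gg (q + 1 - r) (r + 1) - gg (q + 1 - r) r) := by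
  intro k
  induction k with
  | zero =>
    intro r hr h1
    have : r = q + 1 := by omega
    subst this
    simp [gg]
  | succ k ih =>
    intro r hr h1
    rw [Finset.sum_eq_sum_Ico_succ_bot (by omega), ih (r + 1) (by omega) (by omega)]
    obtain ⟨r, rfl⟩ : ∃ r', r = r' + 1 := ⟨r - 1, by omega⟩
    have e1 : q + 1 - (r + 1) = k + 1 := by omega
    have e2 : q - (r + 1) = k := by omega
    have e3 : q + 1 - (r + 1 + 1) = k := by omega
    rw [aa, e1, e2, e3, gg, gg]
    ring

theorem sum_aa (q : ℕ) : ∑ i ∈ Finset.Ico 0 (q + 1), aa q i = gg (q + 2) 0 := by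
  rw [Finset.sum_eq_sum_Ico_succ_bot (by omega), sum_aa_tail q q (0 + 1) (by omega) (by omega)]
  rw [aa, gg, gg, gg]
  simp
  ring

theorem sum_rank (f : ℕ → ℚ[X]) (c : ℕ) (t : Finset ℕ) (hc : c ∉ t) :
    ∑ d ∈ t, (if c < d then f ((t.erase d).filter (· < d)).card else 0) =
      ∑ i ∈ Finset.Ico (t.filter (· < c)).card t.card, f i := by
  induction t using Finset.induction_on_max with
  | empty => simp
  | insert M t hM ih =>
    have hMt : M ∉ t := fun h => lt_irrefl _ (hM M h)
    simp only [Finset.mem_insert, not_or] at hc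
    have ih := ih hc.2
    rw [Finset.sum_insert hMt, Finset.card_insert_of_notMem hMt]
    have h1 : ∀ d ∈ t, (if c < d then f (((insert M t).erase d).filter (· < d)).card else 0) =
        (if c < d then f ((t.erase d).filter (· < d)).card else 0) := by
      intro d hd
      have : ((insert M t).erase d).filter (· < d) = (t.erase d).filter (· < d) := by
        ext x
        simp only [Finset.mem_filter, Finset.mem_erase, Finset.mem_insert]
        have := hM d hd
        constructor
        · rintro ⟨⟨h1, h2 | h2⟩, h3⟩
          · omega
          · exact ⟨⟨h1, h2⟩, h3⟩
        · tauto
      rw [this]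
    rw [Finset.sum_congr rfl h1, ih]
    have h2 : ((insert M t).erase M).filter (· < M) = t := by
      rw [Finset.erase_insert hMt]
      exact Finset.filter_true_of_mem hM
    rw [h2]
    by_cases hcM : c < M
    · have h3 : (insert M t).filter (· < c) = t.filter (· < c) := by
        rw [Finset.filter_insert, if_neg (by omega)]
      rw [h3, if_pos hcM, Finset.sum_Ico_succ_top (Finset.card_filter_le _ _), add_comm]
    · have h3 : (insert M t).filter (· < c) = insert M t := by
        apply Finset.filter_true_of_mem
        intro x hx
        rcases Finset.mem_insert.mp hx with rfl | hx
        · omega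
        · have := hM x hx; omega
      have h4 : t.filter (· < c) = t := by
        apply Finset.filter_true_of_mem
        intro x hx
        have := hM x hx; omega
      rw [h3, h4, if_neg hcM, Finset.card_insert_of_notMem hMt]
      simp

theorem sum_uu_min (s : Finset ℕ) (m : ℕ) (hm : m ∈ s) (hmin : ∀ x ∈ s.erase m, m < x) :
    ∑ l ∈ LL s, uu l = ∑ l ∈ LL (s.erase m), uu (m :: l) := by
  rw [sum_LL s ⟨m, hm⟩]
  refine Finset.sum_eq_single_of_mem m hm ?_
  intro b hb hbm
  refine Finset.sum_eq_zero fun l hl => ?_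
  rw [mem_LL] at hl
  refine uu_eq_zero (x := m) ?_ (hmin b (by simp [hb, hbm]))
  rw [← List.mem_toFinset, hl.2]
  simp [hm, Ne.symm hbm]

theorem exists_min (s : Finset ℕ) (hs : s.Nonempty) : ∃ m ∈ s, ∀ x ∈ s.erase m, m < x := by
  refine ⟨s.min' hs, s.min'_mem hs, fun x hx => ?_⟩
  rw [Finset.mem_erase] at hx
  have := s.min'_le x hx.2
  omega

theorem sum_pair : ∀ (p : ℕ) (_ : ∀ s : Finset ℕ, s.card ≤ p + 1 → ∑ l ∈ LL s, uu l = gg s.card 0)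
    (s : Finset ℕ) (a c : ℕ), s.card = p → a < c → (∀ x ∈ s, a < x) → c ∉ s →
    ∑ l ∈ LL s, uu (a :: c :: l) = aa p (s.filter (· < c)).card := by
  intro p
  induction p using Nat.strong_induction_on with
  | _ p ih =>
  intro hV s a c hs hac has hc
  rcases Nat.eq_zero_or_pos (s.filter (· < c)).card with hr | hr
  · rw [hr]
    have hcs : ∀ x ∈ s, c < x := by
      intro x hx
      rw [Finset.card_eq_zero, Finset.filter_eq_empty_iff] at hr
      have h1 := hr hx
      have h2 : x ≠ c := fun h => hc (h ▸ hx)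
      omega
    have h1 : ∀ l ∈ LL s, uu (a :: c :: l) = -X * (uu (c :: l) + uu l) := by
      intro l hl
      rw [mem_LL] at hl
      match l with
      | [] => simp [uu, hac]; ring
      | d :: l =>
        exact uu_asc_asc a c d l hac (hcs d (by rw [← hl.2]; simp))
    rw [Finset.sum_congr rfl h1, ← Finset.mul_sum, Finset.sum_add_distrib, aa]
    have h2 := hV (insert c s) (by rw [Finset.card_insert_of_notMem hc]; omega)
    rw [Finset.card_insert_of_notMem hc, sum_uu_min _ c (by simp)
      (by rw [Finset.erase_insert hc]; exact hcs), Finset.erase_insert hc] at h2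
    rw [h2, hV s (by omega), hs]
  · have hsne : s.Nonempty := by
      obtain ⟨x, hx⟩ := Finset.card_pos.mp hr
      exact ⟨x, (Finset.mem_filter.mp hx).1⟩
    obtain ⟨m, hm, hmin⟩ := exists_min s hsne
    set t := s.erase m with ht
    have hst : s = insert m t := (Finset.insert_erase hm).symm
    have hmt : m ∉ t := by simp [ht]
    have htc : t.card + 1 = p := by rw [ht, Finset.card_erase_add_one hm, hs]
    have hct : c ∉ t := fun h => hc (Finset.mem_of_mem_erase h)
    have hmc : m < c := by
      obtain ⟨x, hx⟩ := Finset.card_pos.mp hr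
      rw [Finset.mem_filter] at hx
      by_cases hxm : x = m
      · omega
      · have := hmin x (by simp [ht, hxm, hx.1]); omega
    have hr' : (s.filter (· < c)).card = (t.filter (· < c)).card + 1 := by
      rw [hst, Finset.filter_insert, if_pos hmc, Finset.card_insert_of_notMem (by simp [hmt])]
    rw [hr']
    set r := (t.filter (· < c)).card with hrdef
    have ham : a < m := has m hm
    rw [sum_LL s hsne]
    rcases Finset.eq_empty_or_nonempty t with hte | htne
    · have hp : p = 1 := by rw [hte] at htc; simpa using htc.symm
      have hr0 : r = 0 := by rw [hrdef, hte]; simp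
      rw [hst, hte, hr0, hp]
      simp [LL_empty, uu, aa, gg]
      try omega
    · have key : ∀ b ∈ s, ∑ l ∈ LL (s.erase b), uu (a :: c :: b :: l) = if b = m then
          ∑ d ∈ t, ∑ l ∈ LL (t.erase d), ((if c < d then -X * uu (m :: d :: l) else 0) -
            if r = 0 then X ^ 2 * uu (d :: l) else 0) else 0 := by
        intro b hb
        have hne : (s.erase b).Nonempty := by
          rw [← Finset.card_pos, Finset.card_erase_of_mem hb]
          have := Finset.card_pos.mpr htne
          omega
        rw [sum_LL _ hne]
        by_cases hbm : b = m
        · rw [if_pos hbm]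
          subst hbm
          refine Finset.sum_congr rfl fun d hd => Finset.sum_congr rfl fun l hl => ?_
          rw [mem_LL] at hl
          have hdc : d ≠ c := fun h => hct (h ▸ hd)
          rw [uu]
          simp only [hac, if_true, show ¬ c < b by omega, if_false, ham, true_and]
          by_cases hcd : c < d
          · simp only [hcd, if_true]
            by_cases h0 : r = 0
            · simp [h0]
            · simp only [h0, if_false]
              obtain ⟨x, hx⟩ := Finset.card_pos.mp (Nat.pos_of_ne_zero h0)
              rw [Finset.mem_filter] at hx
              have : uu (d :: l) = 0 := by
                refine uu_eq_zero (x := x) ?_ (by omega)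
                rw [← List.mem_toFinset, hl.2, Finset.mem_erase]
                exact ⟨by omega, hx.1⟩
              simp [this]
          · have h0 : r ≠ 0 := by
              rw [hrdef]
              apply Nat.pos_iff_ne_zero.mp
              rw [Finset.card_pos]
              exact ⟨d, Finset.mem_filter.mpr ⟨hd, by omega⟩⟩
            simp [hcd, h0]
        · rw [if_neg hbm]
          refine Finset.sum_eq_zero fun d hd => Finset.sum_eq_zero fun l hl => ?_
          rw [mem_LL] at hl
          have hmb : m < b := hmin b (by simp [ht, hbm, hb])
          have hmem : m ∈ d :: l := by
            by_cases hmd : m = d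
            · simp [hmd]
            · have : m ∈ l := by
                rw [← List.mem_toFinset, hl.2]
                simp [hmd, hm, Ne.symm hbm]
              simp [this]
          have hb0 : uu (b :: d :: l) = 0 := uu_eq_zero hmem hmb
          have hc0 : uu (c :: b :: d :: l) = 0 := uu_eq_zero (List.mem_cons_of_mem _ hmem) hmc
          rw [uu, hb0, hc0]
          by_cases hcd : c < d
          · have : m ∈ l := by
              rcases List.mem_cons.mp hmem with h | h
              · omega
              · exact h
            have hd0 : uu (d :: l) = 0 := uu_eq_zero this (by omega)
            simp [hd0]
          · simp [hcd]
      rw [Finset.sum_congr rfl key, Finset.sum_ite_eq' s m, if_pos hm]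
      simp only [Finset.sum_sub_distrib]
      have hq : ∃ q, p = q + 2 := ⟨p - 2, by have := Finset.card_pos.mpr htne; omega⟩
      obtain ⟨q, rfl⟩ := hq
      have hp1 : ∀ d ∈ t, ∑ l ∈ LL (t.erase d), (if c < d then -X * uu (m :: d :: l) else 0) =
          -X * (if c < d then aa q ((t.erase d).filter (· < d)).card else 0) := by
        intro d hd
        split_ifs
        · rw [← Finset.mul_sum, ih q (by omega) (fun s hs => hV s (by omega)) (t.erase d) m d
            (by rw [Finset.card_erase_of_mem hd]; omega) (hmin d hd)
            (fun x hx => hmin x (Finset.mem_of_mem_erase hx)) (by simp)]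
        · simp
      rw [Finset.sum_congr rfl hp1, ← Finset.mul_sum, sum_rank _ c t hct, ← hrdef,
        show t.card = q + 1 by omega]
      have hrq : r ≤ q + 1 := by
        have := Finset.card_filter_le t (· < c); omega
      by_cases h0 : r = 0
      · simp only [h0, if_true, ← Finset.mul_sum]
        rw [sum_aa, ← sum_LL t htne, hV t (by omega), show t.card = q + 1 by omega, aa,
          show q + 2 - (0 + 1) = q + 1 by omega, gg]
        ring
      · simp only [h0, if_false, Finset.sum_const_zero, sub_zero]
        rw [sum_aa_tail q (q + 1 - r) r (by omega) (by omega), aa,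
          show q + 2 - (r + 1) = q + 1 - r by omega]
        ring

theorem sum_uu : ∀ (n : ℕ) (s : Finset ℕ), s.card = n → ∑ l ∈ LL s, uu l = gg n 0 := by
  intro n
  induction n using Nat.strong_induction_on with
  | _ n ih =>
  intro s hs
  match n with
  | 0 =>
    rw [Finset.card_eq_zero] at hs
    subst hs
    simp [LL_empty, uu, gg]
  | 1 =>
    obtain ⟨x, rfl⟩ := Finset.card_eq_one.mp hs
    rw [sum_LL _ (by simp)]
    simp [LL_empty, uu, gg]
  | q + 2 =>
    obtain ⟨m, hm, hmin⟩ := exists_min s (by rw [← Finset.card_pos]; omega)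
    rw [sum_uu_min s m hm hmin]
    set t := s.erase m with ht
    have htc : t.card = q + 1 := by rw [ht, Finset.card_erase_of_mem hm, hs]; rfl
    rw [sum_LL t (by rw [← Finset.card_pos]; omega)]
    have h1 : ∀ d ∈ t, ∑ l ∈ LL (t.erase d), uu (m :: d :: l) =
        if m < d then aa q ((t.erase d).filter (· < d)).card else 0 := by
      intro d hd
      rw [if_pos (hmin d hd)]
      exact sum_pair q (fun s hs => ih _ (by omega) s rfl) (t.erase d) m d
            (by rw [Finset.card_erase_of_mem hd]; omega) (hmin d hd)
            (fun x hx => hmin x (Finset.mem_of_mem_erase hx)) (by simp)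
    rw [Finset.sum_congr rfl h1, sum_rank _ m t (by simp [ht]), htc]
    have : t.filter (· < m) = ∅ := by
      rw [Finset.filter_eq_empty_iff]
      intro x hx
      have := hmin x hx; omega
    rw [this, Finset.card_empty, sum_aa]

theorem conv_zero (s : Finset ℕ) (hs : s.Nonempty) :
    ∑ A ∈ s.powerset, (∑ l ∈ LL A, ww l) * gg (s.card - A.card) 0 = 0 := by
  have h := sum_cv _ s ww rfl
  rw [Finset.sum_eq_zero] at h
  · rw [h]
    refine Finset.sum_congr rfl fun A hA => ?_
    rw [sum_uu _ (s \ A) rfl, Finset.card_sdiff_of_subset (Finset.mem_powerset.mp hA)]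
  · intro l hl
    refine cv_ww _ l rfl ?_
    rintro rfl
    rw [mem_LL] at hl
    simp at hl
    simp [← hl] at hs

theorem sum_ww : ∀ (n : ℕ) (s : Finset ℕ), s.card = n → ∑ l ∈ LL s, ww l = NMpoly GG0 n := by
  intro n
  induction n using Nat.strong_induction_on with
  | _ n ih =>
  have main : ∀ s : Finset ℕ, s.card = n → s.Nonempty → ∑ l ∈ LL s, ww l =
      - (∑ m ∈ Finset.range n, n.choose m • (NMpoly GG0 m * gg (n - m) 0)) := by
    intro s hs hne
    have h := conv_zero s hne
    have h2 : ∑ A ∈ s.powerset, (if A.card < n then NMpoly GG0 A.card * gg (n - A.card) 0 else 0) =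
      ∑ m ∈ Finset.range (n + 1), n.choose m •
        (if m < n then NMpoly GG0 m * gg (n - m) 0 else 0) := by
      have := Finset.sum_powerset_apply_card
        (fun m => if m < n then NMpoly GG0 m * gg (n - m) 0 else 0) (x := s)
      rw [hs] at this
      exact this
    rw [Finset.sum_range_succ] at h2
    have h3 : ∑ m ∈ Finset.range n, n.choose m •
        (if m < n then NMpoly GG0 m * gg (n - m) 0 else 0) =
        ∑ m ∈ Finset.range n, n.choose m • (NMpoly GG0 m * gg (n - m) 0) :=
      Finset.sum_congr rfl fun m hm => by rw [if_pos (Finset.mem_range.mp hm)]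
    rw [h3] at h2
    simp only [lt_irrefl, if_false, smul_zero, add_zero] at h2
    rw [← h2]
    rw [← Finset.add_sum_erase _ _ (Finset.mem_powerset_self s)] at h ⊢
    have h4 : ∀ A ∈ s.powerset.erase s, (∑ l ∈ LL A, ww l) * gg (s.card - A.card) 0 =
        (if A.card < n then NMpoly GG0 A.card * gg (n - A.card) 0 else 0) := by
      intro A hA
      rw [Finset.mem_erase, Finset.mem_powerset] at hA
      have : A.card < n := by
        rw [← hs]; exact Finset.card_lt_card (lt_of_le_of_ne hA.2 hA.1)
      rw [if_pos this, ih _ this A rfl, hs]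
    rw [Finset.sum_congr rfl h4] at h
    simp only [hs, lt_irrefl, if_false, zero_add, Nat.sub_self, gg, mul_one] at h ⊢
    exact eq_neg_of_add_eq_zero_left h
  intro s hs
  rcases Nat.eq_zero_or_pos n with rfl | hn
  · rw [Finset.card_eq_zero] at hs
    subst hs
    simp [LL_empty, ww, NMpoly]
  · rw [main s hs (by rw [← Finset.card_pos]; omega), NM_eq,
      main (Finset.Icc 1 n) (by simp) (by rw [← Finset.card_pos, Nat.card_Icc]; omega)]

theorem gg_conv (n : ℕ) (hn : 1 ≤ n) :
    ∑ k ∈ Finset.range (n + 1), (n.choose k : ℚ) • (gg k 0 * NMpoly GG0 (n - k)) = 0 := by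
  have h := conv_zero (Finset.Icc 1 n) (by rw [← Finset.card_pos, Nat.card_Icc]; omega)
  have h1 := Finset.sum_powerset_apply_card
        (fun m => NMpoly GG0 m * gg (n - m) 0) (x := Finset.Icc 1 n)
  simp only [Nat.card_Icc, Nat.add_sub_cancel] at h h1
  rw [Finset.sum_congr rfl (fun A _ => by rw [sum_ww _ A rfl]), h1] at h
  rw [← Finset.sum_range_reflect, ← h]
  refine Finset.sum_congr rfl fun k hk => ?_
  rw [Finset.mem_range] at hk
  rw [show n + 1 - 1 - k = n - k by omega, Nat.choose_symm (by omega),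
    show n - (n - k) = k by omega, mul_comm, Nat.cast_smul_eq_nsmul]

/-- Ballot numbers. -/
def bal (n h i : ℕ) : ℚ :=
  if n ≤ 2 * i + h then (n.choose i : ℚ) - (n.choose (i + h + 1) : ℚ) else 0

theorem bal_succ (n h i : ℕ) : bal (n + 1) (h + 1) (i + 1) = bal n (h + 2) i + bal n h (i + 1) := by
  unfold bal
  rw [Nat.choose_succ_succ, show i + 1 + (h + 1) + 1 = (i + h + 2) + 1 by ring,
    Nat.choose_succ_succ, show i + (h + 2) + 1 = i + h + 2 + 1 by ring,
    show i + 1 + h + 1 = i + h + 2 by ring]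
  split_ifs <;> first | omega | (push_cast; ring)

theorem bal_succ_zero (n h : ℕ) : bal (n + 1) (h + 1) 0 = bal n h 0 := by
  unfold bal
  split_ifs with h1 h2 h2
  · rw [Nat.choose_eq_zero_of_lt (show n + 1 < 0 + (h + 1) + 1 by omega),
      Nat.choose_eq_zero_of_lt (show n < 0 + h + 1 by omega)]
    simp
  · omega
  · omega
  · rfl

theorem bal_zero_succ (n i : ℕ) : bal (n + 1) 0 (i + 1) = bal n 1 i := by
  unfold bal
  rw [Nat.choose_succ_succ, show i + 1 + 0 + 1 = (i + 1) + 1 by ring, Nat.choose_succ_succ]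
  split_ifs <;> first | omega | (push_cast; ring)

theorem gg_eq (n : ℕ) : ∀ (h N : ℕ), n < N →
    gg n h = ∑ i ∈ Finset.range N, C (bal n h i) * (-X) ^ i := by
  induction n with
  | zero =>
    intro h N hN
    rw [Finset.sum_eq_single_of_mem 0 (by simpa using hN)]
    · simp [gg, bal]
    · intro i _ hi
      have : bal 0 h i = 0 := by
        unfold bal
        rw [Nat.choose_eq_zero_of_lt (by omega), Nat.choose_eq_zero_of_lt (by omega)]
        simp
      simp [this]
  | succ n ih =>
    intro h N hN
    obtain ⟨N, rfl⟩ : ∃ M, N = M + 1 := ⟨N - 1, by omega⟩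
    rw [Finset.sum_range_succ']
    match h with
    | 0 =>
      have : bal (n + 1) 0 0 = 0 := by simp [bal]
      rw [this, gg, ih 1 N (by omega), Finset.mul_sum]
      simp only [bal_zero_succ, map_zero, zero_mul, add_zero]
      exact Finset.sum_congr rfl fun i _ => by ring
    | h + 1 =>
      rw [gg, ih (h + 2) N (by omega), ih h (N + 1) (by omega), Finset.mul_sum,
        Finset.sum_range_succ', bal_succ_zero, ← add_assoc, ← Finset.sum_add_distrib]
      congr 1
      refine Finset.sum_congr rfl fun i _ => ?_
      rw [bal_succ, C_add]; ring

theorem gg_odd (n : ℕ) : gg (2 * n + 1) 0 = ∑ k ∈ Finset.range (n + 1),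
        Polynomial.C (2 * ((k : ℚ) + 1) * ((2 * n + 1).choose (n - k) : ℚ) / ((n : ℚ) + k + 2)) *
          (-X : Polynomial ℚ) ^ (n + k + 1) := by
  rw [gg_eq (2 * n + 1) 0 ((n + 1) + (n + 1)) (by omega), Finset.sum_range_add,
    Finset.sum_eq_zero, zero_add]
  · refine Finset.sum_congr rfl fun k hk => ?_
    rw [Finset.mem_range] at hk
    rw [show n + 1 + k = n + k + 1 by ring]
    congr 2
    unfold bal
    rw [if_pos (by omega)]
    have h1 : (2 * n + 1).choose (n - k) = (2 * n + 1).choose (n + k + 1) := by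
      rw [← Nat.choose_symm (show n - k ≤ 2 * n + 1 by omega)]
      congr 1; omega
    have h2 := Nat.choose_succ_right_eq (2 * n + 1) (n + k + 1)
    rw [show 2 * n + 1 - (n + k + 1) = n - k by omega] at h2
    have h3 : ((2 * n + 1).choose (n + k + 1 + 1) : ℚ) * ((n : ℚ) + k + 1 + 1) =
        ((2 * n + 1).choose (n + k + 1) : ℚ) * ((n : ℚ) - k) := by
      rw [← Nat.cast_sub (by omega)]
      exact_mod_cast h2
    rw [h1, eq_div_iff (by positivity), add_zero]
    linear_combination -h3
  · intro i hi
    rw [Finset.mem_range] at hi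
    have : bal (2 * n + 1) 0 i = 0 := by
      unfold bal; rw [if_neg (by omega)]
    simp [this]

theorem stmt10 (Γ : Set (List ℕ)) (hΓ : Γ = {[1, 3, 2, 4], [1, 2, 3]})
    (U : ℤ → Polynomial ℚ)
    (hUneg : ∀ m : ℤ, m < 0 → U m = 0)
    (hU0 : U 0 = 1)
    (hUrec : ∀ n : ℕ, 1 ≤ n →
      ∑ k ∈ Finset.range (n + 1), (n.choose k : ℚ) • (U (k : ℤ) * NMpoly Γ (n - k)) = 0) :
    ∀ n : ℕ,
      U ((2 * n + 1 : ℕ) : ℤ) = ∑ k ∈ Finset.range (n + 1),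
        Polynomial.C (2 * ((k : ℚ) + 1) * ((2 * n + 1).choose (n - k) : ℚ) / ((n : ℚ) + k + 2)) *
          (-X : Polynomial ℚ) ^ (n + k + 1) := by
  have hU : ∀ n : ℕ, U (n : ℤ) = gg n 0 := by
    intro n
    induction n using Nat.strong_induction_on with
    | _ n ih =>
    rcases Nat.eq_zero_or_pos n with rfl | hn
    · simpa [gg] using hU0
    · have h1 := hUrec n hn
      have h2 := gg_conv n hn
      have hΓ' : Γ = GG0 := hΓ
      rw [hΓ', Finset.sum_range_succ] at h1
      rw [Finset.sum_range_succ] at h2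
      rw [Finset.sum_congr rfl (fun k hk => by rw [ih k (Finset.mem_range.mp hk)])] at h1
      have h3 := h1.trans h2.symm
      simpa [NMpoly] using add_left_cancel h3
  intro n
  rw [hU, gg_odd]
end

section
/- Let Γ = {1324, 123}. For n ≥ 0 and 0 ≤ k ≤ n, let F_{2n+1,2k+1} be the set of pairs (B, σ) where B = (b_1, …, b_ℓ) is a composition of 2n+1 having exactly 2k+1 parts equal to 1 and exactly n−k parts equal to 2 (so ℓ = n+k+1), σ ∈ S_{2n+1}, σ is increasing within each brick, the first entries of the bricks increase from left to right, and whenever σ has a descent at the boundary between two consecutive bricks there is a Γ-match of σ contained entirely in the positions covered by those two bricks. Then |F_{2n+1,2k+1}| = 2(k+1)·binom(2n+1, n−k)/(n+k+2). -/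
open Polynomial

/-- Conditions on a pair `(B, σ)`: `σ` is increasing within each brick, the first entries of
the bricks increase from left to right, and whenever `σ` has a descent at a brick boundary,
there is a `Γ`-match of `σ` contained in the positions covered by the two adjacent bricks. -/
def FixedPt (Γ : Set (List ℕ)) (n : ℕ) (c : Composition n) (σ : List ℕ) : Prop :=
  (∀ p : ℕ, p + 1 < n → (¬ ∃ i, i < c.length ∧ c.sizeUpTo i = p + 1) →
    σ.getD p 0 < σ.getD (p + 1) 0) ∧
  (∀ i : ℕ, i + 1 < c.length →
    σ.getD (c.sizeUpTo i) 0 < σ.getD (c.sizeUpTo (i + 1)) 0) ∧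
  (∀ i : ℕ, i + 1 < c.length →
    σ.getD (c.sizeUpTo (i + 1)) 0 < σ.getD (c.sizeUpTo (i + 1) - 1) 0 →
    ∃ a j : ℕ, 1 ≤ j ∧ c.sizeUpTo i ≤ a ∧ a + j + 1 ≤ c.sizeUpTo (i + 2) ∧
      redL ((σ.drop a).take (j + 1)) ∈ Γ)


def brk (p : ℕ × ℕ) : List ℕ := if p.1 = p.2 then [p.1] else [p.1, p.2]

def flatB (L : List (ℕ × ℕ)) : List ℕ := L.flatMap brk

/-- partial configurations with values in `(v, N]` -/
structure Good (N v : ℕ) (s : List ℕ × List (ℕ × ℕ)) : Prop where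
  perm : (s.1 ++ flatB s.2).Perm (List.range' (v + 1) (N - v))
  dec : s.1.Pairwise (· > ·)
  le : ∀ p ∈ s.2, p.1 ≤ p.2
  chain : s.2.Pairwise (fun p p' => p.1 < p'.1 ∧ p.2 < p'.2)
  lt : ∀ x ∈ s.1, ∀ p ∈ s.2, x < p.2

def stepD (v : ℕ) (s : List ℕ × List (ℕ × ℕ)) : List ℕ × List (ℕ × ℕ) := (s.1 ++ [v], s.2)

def stepU (v : ℕ) (s : List ℕ × List (ℕ × ℕ)) : List ℕ × List (ℕ × ℕ) :=
  (s.1.tail, (v, s.1.headD v) :: s.2)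

lemma flt_cons (p : ℕ × ℕ) (L : List (ℕ × ℕ)) : flatB (p :: L) = brk p ++ flatB L := by
  simp [flatB]

lemma fst_mem_brk (p : ℕ × ℕ) : p.1 ∈ brk p := by unfold brk; split <;> simp
lemma snd_mem_brk (p : ℕ × ℕ) : p.2 ∈ brk p := by unfold brk; split <;> simp_all
lemma mem_brk {x : ℕ} {p : ℕ × ℕ} (h : x ∈ brk p) : x = p.1 ∨ x = p.2 := by
  unfold brk at h; split at h <;> simp_all
lemma mem_flt {x : ℕ} {L : List (ℕ × ℕ)} : x ∈ flatB L ↔ ∃ p ∈ L, x ∈ brk p := by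
  simp [flatB]

lemma range_step {N v : ℕ} (hv : v < N) :
    List.range' (v + 1) (N - v) = (v + 1) :: List.range' (v + 1 + 1) (N - (v + 1)) := by
  rw [show N - v = (N - (v + 1)) + 1 by omega, List.range'_succ]

lemma Good.gt {N v : ℕ} {s} (h : Good N v s) {x : ℕ} (hx : x ∈ s.1 ++ flatB s.2) : v < x := by
  have := h.perm.mem_iff.1 hx
  rw [List.mem_range'_1] at this
  omega

lemma good_stepD {N v : ℕ} (hv : v < N) {s} (h : Good N (v + 1) s) :
    Good N v (stepD (v + 1) s) := by
  obtain ⟨q, L⟩ := s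
  refine ⟨?_, ?_, h.le, h.chain, ?_⟩
  · rw [range_step hv]
    have := h.perm
    simp only [stepD] at this ⊢
    refine List.Perm.trans ?_ (this.cons (v + 1))
    rw [List.append_assoc, List.singleton_append]
    exact List.perm_middle
  · simp only [stepD]
    rw [List.pairwise_append]
    refine ⟨h.dec, by simp, ?_⟩
    intro a ha b hb
    simp at hb
    subst hb
    exact h.gt (by simp; exact Or.inl ha)
  · intro x hx p hp
    simp only [stepD, List.mem_append, List.mem_singleton] at hx hp
    rcases hx with hx | rfl
    · exact h.lt x hx p hp
    · exact h.gt (by simp only [List.mem_append]; exact Or.inr (mem_flt.2 ⟨p, hp, snd_mem_brk p⟩))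

lemma good_stepU {N v : ℕ} (hv : v < N) {s} (h : Good N (v + 1) s) :
    Good N v (stepU (v + 1) s) := by
  obtain ⟨q, L⟩ := s
  have hf : ∀ p ∈ L, v + 1 < p.1 := fun p hp =>
    h.gt (by simp only [List.mem_append]; exact Or.inr (mem_flt.2 ⟨p, hp, fst_mem_brk p⟩))
  have hf2 : ∀ p ∈ L, v + 1 < p.2 := fun p hp =>
    h.gt (by simp only [List.mem_append]; exact Or.inr (mem_flt.2 ⟨p, hp, snd_mem_brk p⟩))
  cases q with
  | nil =>
    refine ⟨?_, by simp [stepU], ?_, ?_, by simp [stepU]⟩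
    · rw [range_step hv]
      have := h.perm
      simp only [stepU, flt_cons, brk] at this ⊢
      simpa using this
    · intro p hp
      simp only [stepU, List.mem_cons] at hp
      rcases hp with rfl | hp
      · simp
      · exact h.le p hp
    · simp only [stepU, List.pairwise_cons]
      exact ⟨fun p hp => ⟨hf p hp, by simpa using hf2 p hp⟩, h.chain⟩
  | cons s q =>
    have hs : v + 1 < s := h.gt (by simp)
    refine ⟨?_, ?_, ?_, ?_, ?_⟩
    · rw [range_step hv]
      have := h.perm
      simp only [stepU, flt_cons, brk, List.tail_cons, List.headD_cons] at this ⊢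
      rw [if_neg (by omega)]
      refine List.Perm.trans ?_ (this.cons (v + 1))
      refine List.perm_append_comm_assoc _ _ _ |>.trans ?_
      simp
    · exact (List.pairwise_cons.1 h.dec).2
    · intro p hp
      simp only [stepU, List.mem_cons] at hp
      rcases hp with rfl | hp
      · simp; omega
      · exact h.le p hp
    · simp only [stepU, List.pairwise_cons]
      exact ⟨fun p hp => ⟨hf p hp, by simpa using h.lt s (by simp) p hp⟩, h.chain⟩
    · intro x hx p hp
      simp only [stepU, List.mem_cons, List.tail_cons] at hx hp
      rcases hp with rfl | hp
      · exact (List.pairwise_cons.1 h.dec).1 x hx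
      · exact h.lt x (by simp [hx]) p hp

lemma good_inv {N v : ℕ} (hv : v < N) {s} (h : Good N v s) :
    ∃ t, Good N (v + 1) t ∧ (s = stepD (v + 1) t ∨ s = stepU (v + 1) t) := by
  obtain ⟨q, L⟩ := s
  have hm : v + 1 ∈ q ++ flatB L := by
    rw [h.perm.mem_iff, range_step hv]; simp
  have hperm := h.perm
  rw [range_step hv] at hperm
  by_cases hq : v + 1 ∈ q
  · rcases List.eq_nil_or_concat q with rfl | ⟨q0, z, rfl⟩
    · simp at hq
    simp only [List.concat_eq_append] at *
    have hd := List.pairwise_append.1 h.dec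
    have hz : v < z := h.gt (by simp)
    have hzv : z = v + 1 := by
      rcases List.mem_append.1 hq with hq | hq
      · have := hd.2.2 _ hq z (by simp)
        omega
      · simp at hq; omega
    subst hzv
    refine ⟨(q0, L), ⟨?_, hd.1, h.le, h.chain, fun x hx p hp => h.lt x (by simp [hx]) p hp⟩,
      Or.inl rfl⟩
    refine (List.perm_cons (v + 1)).1 (List.Perm.trans ?_ hperm)
    simp only [List.append_assoc, List.singleton_append]
    exact List.perm_middle.symm
  · have hL : v + 1 ∈ flatB L := by
      rcases List.mem_append.1 hm with h | h
      · exact absurd h hq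
      · exact h
    cases L with
    | nil => simp [flatB] at hL
    | cons p L =>
      have hc := List.pairwise_cons.1 h.chain
      have hp1 : v < p.1 := h.gt (by simp [flt_cons, fst_mem_brk])
      have hple : p.1 ≤ p.2 := h.le p (by simp)
      have hp : p.1 = v + 1 := by
        obtain ⟨p', hp', hx⟩ := mem_flt.1 hL
        have hle := h.le p' hp'
        rcases List.mem_cons.1 hp' with rfl | hp'
        · rcases mem_brk hx with hx | hx <;> omega
        · have := hc.1 p' hp'
          rcases mem_brk hx with hx | hx <;> omega
      obtain ⟨x, y⟩ := p
      simp only at hp hp1 hple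
      subst hp
      by_cases hxy : v + 1 = y
      · subst hxy
        have hq0 : q = [] := by
          rw [List.eq_nil_iff_forall_not_mem]
          intro x hx
          have h1 := h.lt x hx (v + 1, v + 1) (by simp)
          have h2 : v < x := h.gt (by simp [hx])
          simp only at h1
          omega
        subst hq0
        refine ⟨([], L), ⟨?_, by simp, fun p hp => h.le p (by simp [hp]), hc.2, by simp⟩, Or.inr rfl⟩
        simpa [flt_cons, brk] using hperm
      · refine ⟨(y :: q, L), ⟨?_, ?_, fun p hp => h.le p (by simp [hp]), hc.2, ?_⟩, Or.inr rfl⟩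
        · refine (List.perm_cons (v + 1)).1 (List.Perm.trans ?_ hperm)
          simp only [flt_cons, brk, hxy, if_false]
          refine List.Perm.trans ?_ (List.perm_append_comm_assoc _ _ _)
          simp
        · exact List.pairwise_cons.2 ⟨fun x hx => h.lt x hx (v + 1, y) (by simp), h.dec⟩
        · intro x hx p hp
          rcases List.mem_cons.1 hx with rfl | hx
          · exact (hc.1 p hp).2
          · exact h.lt x hx p (by simp [hp])

def W (N : ℕ) : ℕ → List (List ℕ × List (ℕ × ℕ))
  | 0 => [([], [])]
  | m + 1 => (W N m).map (stepD (N - m)) ++ (W N m).map (stepU (N - m))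

lemma mem_W (N : ℕ) : ∀ m v, m + v = N → ∀ s, s ∈ W N m ↔ Good N v s
  | 0, v, h, s => by
    obtain rfl : v = N := by omega
    constructor
    · intro hs
      simp [W] at hs
      subst hs
      exact ⟨by simp [flatB], by simp, by simp, by simp, by simp⟩
    · intro hs
      have := hs.perm
      simp at this
      obtain ⟨q, L⟩ := s
      simp at this
      obtain ⟨rfl, h2⟩ := this
      cases L with
      | nil => simp [W]
      | cons p L =>
        have := fst_mem_brk p
        rw [flt_cons] at h2
        simp at h2
        simp [h2.1] at this
  | m + 1, v, h, s => by
    have ih := mem_W N m (v + 1) (by omega)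
    have e : N - m = v + 1 := by omega
    simp only [W, List.mem_append, List.mem_map, e, ih]
    constructor
    · rintro (⟨t, ht, rfl⟩ | ⟨t, ht, rfl⟩)
      · exact good_stepD (by omega) ht
      · exact good_stepU (by omega) ht
    · intro hs
      obtain ⟨t, ht, h1 | h1⟩ := good_inv (by omega) hs
      · exact Or.inl ⟨t, ht, h1.symm⟩
      · exact Or.inr ⟨t, ht, h1.symm⟩

lemma nodup_W (N : ℕ) : ∀ m v, m + v = N → (W N m).Nodup
  | 0, v, h => by simp [W]
  | m + 1, v, h => by
    have ih := nodup_W N m (v + 1) (by omega)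
    have e : N - m = v + 1 := by omega
    simp only [W, e]
    rw [List.nodup_append]
    refine ⟨?_, ?_, ?_⟩
    · refine ih.map ?_
      rintro ⟨q, L⟩ ⟨q', L'⟩ h
      simpa [stepD] using h
    · refine List.Nodup.map_on ?_ ih
      rintro ⟨q, L⟩ hq ⟨q', L'⟩ hq' h
      rw [mem_W N m (v + 1) (by omega)] at hq hq'
      cases q with
      | nil =>
        cases q' with
        | nil => simpa [stepU] using h
        | cons s q' =>
          have : v + 1 < s := hq'.gt (by simp)
          simp [stepU] at h
          omega
      | cons s q =>
        have : v + 1 < s := hq.gt (by simp)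
        cases q' with
        | nil =>
          simp [stepU] at h
          omega
        | cons s q' =>
          simp [stepU] at h
          simp [h]
    · intro a ha b hb hab
      subst hab
      obtain ⟨⟨q, L⟩, hs, rfl⟩ := List.mem_map.1 ha
      obtain ⟨⟨q', L'⟩, ht, h2⟩ := List.mem_map.1 hb
      rw [mem_W N m (v + 1) (by omega)] at hs ht
      simp [stepD, stepU] at h2
      have : v + 1 < v + 1 := ht.gt (List.mem_append_left _ (List.mem_of_mem_tail (by rw [h2.1]; simp)))
      omega

def cnt (N m j l : ℕ) : ℕ := (W N m).countP (fun s => decide (s.1.length = j ∧ s.2.length = l))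

lemma cnt_zero (N j l : ℕ) : cnt N 0 j l = if j = 0 ∧ l = 0 then 1 else 0 := by
  by_cases h : j = 0 ∧ l = 0
  · simp [cnt, W, h.1, h.2]
  · rw [if_neg h, cnt, List.countP_eq_zero]
    simp [W]
    omega

lemma cnt_succ (N m j l : ℕ) : cnt N (m + 1) j l =
    (if j = 0 then 0 else cnt N m (j - 1) l) +
    (if l = 0 then 0 else cnt N m (j + 1) (l - 1) + (if j = 0 then cnt N m 0 (l - 1) else 0)) := by
  unfold cnt
  rw [W, List.countP_append, List.countP_map, List.countP_map]
  congr 1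
  · split_ifs with h
    · rw [List.countP_eq_zero]; simp [stepD, h]
    · congr 1; funext s
      simp only [stepD, Function.comp, List.length_append, List.length_singleton, decide_eq_decide]
      omega
  · split_ifs with h h'
    · rw [List.countP_eq_zero]; simp [stepU, h]
    · subst h'
      induction W N m with
      | nil => simp
      | cons a t ih =>
        simp only [List.countP_cons, ih]
        simp only [stepU, Function.comp, List.length_tail, List.length_cons, decide_eq_true_eq]
        split_ifs <;> omega
    · rw [add_zero]; congr 1; funext s
      simp only [stepU, Function.comp, List.length_tail, List.length_cons, decide_eq_decide]
      omega

lemma cnt_eq (N : ℕ) : ∀ m j l, (cnt N m j l : ℤ) =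
    if m ≤ j + 2 * l then ((m.choose (l + j) : ℤ) - m.choose (l + j + 1)) else 0
  | 0, j, l => by
    rw [cnt_zero]
    by_cases h : j = 0 ∧ l = 0
    · simp [h.1, h.2]
    · rw [if_neg h]
      have : l + j ≠ 0 := by omega
      obtain ⟨r, hr⟩ := Nat.exists_eq_succ_of_ne_zero this
      simp [hr]
  | m + 1, 0, 0 => by
    rw [cnt_succ]; simp
  | m + 1, 0, l + 1 => by
    rw [cnt_succ]
    have h1 := cnt_eq N m 0 l
    have h2 := cnt_eq N m 1 l
    simp only [if_true, Nat.succ_ne_zero, if_false, Nat.add_sub_cancel, zero_add, Nat.cast_add]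
    rw [h1, h2, add_zero, Nat.choose_succ_succ m l, Nat.choose_succ_succ m (l + 1)]
    by_cases c1 : m ≤ 2 * l
    · rw [if_pos (by omega), if_pos (by omega), if_pos (by omega)]
      push_cast; simp; ring
    · by_cases c2 : m = 2 * l + 1
      · rw [if_pos (by omega), if_neg (by omega), if_pos (by omega)]
        have : m.choose l = m.choose (l + 1) := by
          rw [← Nat.choose_symm_of_eq_add (n := m) (a := l) (b := l + 1) (by omega)]
        rw [this]
        push_cast; simp
      · rw [if_neg (by omega), if_neg (by omega), if_neg (by omega)]; simp
  | m + 1, j + 1, 0 => by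
    rw [cnt_succ]
    have h1 := cnt_eq N m j 0
    simp only [if_true, Nat.succ_ne_zero, if_false, Nat.add_sub_cancel, zero_add, Nat.cast_add]
    simp only [Nat.cast_zero, add_zero, h1, zero_add, Nat.mul_zero]
    rw [Nat.choose_succ_succ m j, Nat.choose_succ_succ m (j + 1)]
    by_cases c : m ≤ j
    · rw [if_pos c, if_pos (by omega), Nat.choose_eq_zero_of_lt (show m < j + 1 + 1 by omega)]
      rw [Nat.choose_eq_zero_of_lt (show m < j + 1 by omega)]
      simp
    · rw [if_neg c, if_neg (by omega)]
  | m + 1, j + 1, l + 1 => by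
    rw [cnt_succ]
    have h1 := cnt_eq N m j (l + 1)
    have h2 := cnt_eq N m (j + 1 + 1) l
    simp only [Nat.succ_ne_zero, if_false, Nat.add_sub_cancel, Nat.cast_add, Nat.cast_zero, add_zero]
    rw [h1, h2]
    rw [show l + 1 + (j + 1) = (l + 1 + j) + 1 by ring, Nat.choose_succ_succ m (l + 1 + j),
      Nat.choose_succ_succ m (l + 1 + j + 1), show l + (j + 1 + 1) = l + 1 + j + 1 by ring]
    by_cases c : m ≤ j + 2 * (l + 1)
    · rw [if_pos c, if_pos (by omega), if_pos (by omega)]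
      push_cast; ring
    · rw [if_neg c, if_neg (by omega), if_neg (by omega)]; simp

lemma final_arith (n k : ℕ) (hk : k ≤ n) :
    (((cnt (2 * n + 1) (2 * n + 1) 0 (n + k + 1) : ℕ) : ℚ)) =
    2 * ((k : ℚ) + 1) * ((2 * n + 1).choose (n - k) : ℚ) / ((n : ℚ) + k + 2) := by
  have h := cnt_eq (2 * n + 1) (2 * n + 1) 0 (n + k + 1)
  rw [if_pos (by omega)] at h
  have h' : ((cnt (2 * n + 1) (2 * n + 1) 0 (n + k + 1) : ℕ) : ℚ) =
    ((2 * n + 1).choose (n + k + 1) : ℚ) - (2 * n + 1).choose (n + k + 1 + 1) := by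
    exact_mod_cast h
  have h2 := Nat.choose_succ_right_eq (2 * n + 1) (n + k + 1)
  have h3 : (2 * n + 1).choose (n - k) = (2 * n + 1).choose (n + k + 1) :=
    Nat.choose_symm_of_eq_add (by omega)
  rw [show 2 * n + 1 - (n + k + 1) = n - k by omega] at h2
  have h4 : ((2 * n + 1).choose (n + k + 1 + 1) : ℚ) * (n + k + 1 + 1) =
      ((2 * n + 1).choose (n + k + 1) : ℚ) * (n - k) := by
    rw [← Nat.cast_sub hk]
    exact_mod_cast h2
  rw [h', h3, eq_div_iff (by positivity)]
  linear_combination -h4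

def blk (p : ℕ × ℕ) : ℕ := if p.1 = p.2 then 1 else 2

lemma brk_length (p : ℕ × ℕ) : (brk p).length = blk p := by
  unfold brk blk; split <;> rfl

lemma flt_length (L : List (ℕ × ℕ)) : (flatB L).length = (L.map blk).sum := by
  induction L with
  | nil => rfl
  | cons p L ih => simp [flt_cons, brk_length, ih]

lemma flt_drop (L : List (ℕ × ℕ)) (i : ℕ) :
    (flatB L).drop ((L.map blk).take i).sum = flatB (L.drop i) := by
  induction L generalizing i with
  | nil => simp [flatB]
  | cons p L ih =>
    cases i with
    | zero => simp
    | succ i =>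
      simp only [flt_cons, List.map_cons, List.take_succ_cons, List.sum_cons, List.drop_succ_cons,
        ← brk_length]
      rw [List.drop_append, List.drop_eq_nil_of_le (by omega)]
      simp [ih]

lemma getD_add (l : List ℕ) (a b : ℕ) : l.getD (a + b) 0 = (l.drop a).getD b 0 := by
  simp [List.getD_eq_getElem?_getD, List.getElem?_drop]

lemma red4_s11 {x y z w : ℕ} (h1 : x < z) (h2 : z < y) (h3 : y < w) :
    redL [x, y, z, w] = [1, 3, 2, 4] := by
  simp only [redL, List.map_cons, List.map_nil, List.countP_cons, List.countP_nil, decide_eq_true_eq]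
  simp only [lt_irrefl, if_false, show x < z from h1, show z < y from h2, show y < w from h3,
    show x < y by omega, show x < w by omega, show z < w by omega, show ¬ y < x by omega,
    show ¬ z < x by omega, show ¬ w < x by omega, show ¬ y < z by omega, show ¬ w < z by omega,
    show ¬ w < y by omega, if_true]

lemma red4_inv {x y z w : ℕ} (h : redL [x, y, z, w] = [1, 3, 2, 4]) : y < w := by
  simp only [redL, List.map_cons, List.map_nil, List.countP_cons, List.countP_nil,
    decide_eq_true_eq, List.cons.injEq] at h
  by_contra hc
  obtain ⟨h1, h2, h3, h4, -⟩ := h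
  split_ifs at h4 h2 <;> omega

lemma red3_inv {x y z : ℕ} (h : redL [x, y, z] = [1, 2, 3]) : x < y ∧ y < z := by
  simp only [redL, List.map_cons, List.map_nil, List.countP_cons, List.countP_nil,
    decide_eq_true_eq, List.cons.injEq] at h
  obtain ⟨h1, h2, h3, -⟩ := h
  split_ifs at h1 h2 h3 <;> omega

/-- the boundary condition in local form -/
lemma local_match (p p' : ℕ × ℕ) (R : List ℕ) (hp : p.1 ≤ p.2) (hp' : p'.1 ≤ p'.2)
    (hne : p.2 ≠ p'.1) (h12 : p.1 < p'.1) :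
    (p'.1 < p.2 → ∃ a j : ℕ, 1 ≤ j ∧ a + j + 1 ≤ blk p + blk p' ∧
      redL (((brk p ++ (brk p' ++ R)).drop a).take (j + 1)) ∈
        ({[1, 3, 2, 4], [1, 2, 3]} : Set (List ℕ))) ↔ p.2 < p'.2 := by
  obtain ⟨x, y⟩ := p
  obtain ⟨z, w⟩ := p'
  simp only at hp hp' hne h12 ⊢
  by_cases hxy : x = y
  · subst hxy
    constructor
    · intro _; omega
    · intro _ h; omega
  by_cases hzw : z = w
  · subst hzw
    constructor
    · intro h
      by_contra hc
      obtain ⟨a, j, hj, ha, hr⟩ := h (by omega)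
      simp only [blk, brk, hxy, if_false, if_true] at ha hr
      have hlen := congrArg List.length (rfl : redL (List.take (j + 1) (List.drop a ([x, y] ++ ([z] ++ R)))) = _)
      rcases hr with hr | hr
      · have := congrArg List.length hr
        simp [redL] at this
        omega
      · have := congrArg List.length hr
        simp [redL] at this
        obtain ⟨rfl, rfl⟩ : a = 0 ∧ j = 2 := by omega
        have := red3_inv (x := x) (y := y) (z := z) (by simpa using hr)
        omega
    · intro _ h; omega
  · constructor
    · intro h
      by_cases hc : z < y
      · obtain ⟨a, j, hj, ha, hr⟩ := h hc
        simp only [blk, brk, hxy, hzw, if_false] at ha hr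
        rcases hr with hr | hr
        · have := congrArg List.length hr
          simp [redL] at this
          obtain ⟨rfl, rfl⟩ : a = 0 ∧ j = 3 := by omega
          exact red4_inv (x := x) (y := y) (z := z) (w := w) (by simpa using hr)
        · have := congrArg List.length hr
          simp [redL] at this
          obtain ⟨rfl, rfl⟩ | ⟨rfl, rfl⟩ : (a = 0 ∧ j = 2) ∨ (a = 1 ∧ j = 2) := by omega
          · have := red3_inv (x := x) (y := y) (z := z) (by simpa using hr)
            omega
          · have := red3_inv (x := y) (y := z) (z := w) (by simpa using hr)
            omega
      · omega
    · intro h hc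
      refine ⟨0, 3, by omega, by simp [blk, hxy, hzw], Or.inl ?_⟩
      simp only [brk, hxy, hzw, if_false]
      simpa using red4_s11 (x := x) h12 hc h

lemma brk_getD_zero (p : ℕ × ℕ) (R : List ℕ) : (brk p ++ R).getD 0 0 = p.1 := by
  unfold brk; split <;> simp

lemma brk_getD_last (p : ℕ × ℕ) (R : List ℕ) : (brk p ++ R).getD (blk p - 1) 0 = p.2 := by
  unfold brk blk; split <;> simp_all

lemma blk_pos (p : ℕ × ℕ) : 0 < blk p := by unfold blk; split <;> omega

lemma fixedPt_iff (N : ℕ) (c : Composition N) (L : List (ℕ × ℕ)) (hc : c.blocks = L.map blk)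
    (hnd : (flatB L).Nodup) :
    FixedPt {[1, 3, 2, 4], [1, 2, 3]} N c (flatB L) ↔
      (∀ p ∈ L, p.1 ≤ p.2) ∧ L.Pairwise (fun p p' => p.1 < p'.1 ∧ p.2 < p'.2) := by
  have hlen : c.length = L.length := by rw [← c.blocks_length, hc, List.length_map]
  have hdrop : ∀ i, (flatB L).drop (c.sizeUpTo i) = flatB (L.drop i) := by
    intro i
    rw [Composition.sizeUpTo, hc, flt_drop]
  have hsucc : ∀ i (h : i < L.length), c.sizeUpTo (i + 1) = c.sizeUpTo i + blk L[i] := by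
    intro i h
    rw [c.sizeUpTo_succ (by omega)]
    simp [hc]
  have hd1 : ∀ i (h : i < L.length),
      (flatB L).drop (c.sizeUpTo i) = brk L[i] ++ flatB (L.drop (i + 1)) := by
    intro i h
    rw [hdrop, List.drop_eq_getElem_cons h, flt_cons]
  have hfst : ∀ i (h : i < L.length), (flatB L).getD (c.sizeUpTo i) 0 = L[i].1 := by
    intro i h
    have := getD_add (flatB L) (c.sizeUpTo i) 0
    rw [add_zero] at this
    rw [this, hd1 i h, brk_getD_zero]
  have hlast : ∀ i (h : i < L.length), (flatB L).getD (c.sizeUpTo (i + 1) - 1) 0 = L[i].2 := by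
    intro i h
    have hb := blk_pos L[i]
    have := getD_add (flatB L) (c.sizeUpTo i) (blk L[i] - 1)
    rw [hsucc i h, show c.sizeUpTo i + blk L[i] - 1 = c.sizeUpTo i + (blk L[i] - 1) by omega]
    rw [this, hd1 i h, brk_getD_last]
  -- first condition
  have hA : (∀ p : ℕ, p + 1 < N → (¬ ∃ i, i < c.length ∧ c.sizeUpTo i = p + 1) →
      (flatB L).getD p 0 < (flatB L).getD (p + 1) 0) ↔ ∀ p ∈ L, p.1 ≤ p.2 := by
    constructor
    · intro h p hp
      obtain ⟨i, hi, rfl⟩ := List.getElem_of_mem hp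
      by_cases he : L[i].1 = L[i].2
      · exact he.le
      · have hb : blk L[i] = 2 := by simp [blk, he]
        have hs := hsucc i hi
        have hl := hlast i hi
        rw [hb] at hs
        rw [hs, show c.sizeUpTo i + 2 - 1 = c.sizeUpTo i + 1 by omega] at hl
        have := h (c.sizeUpTo i) (by have := c.sizeUpTo_le (i + 1); omega) ?_
        · rw [hfst i hi, hl] at this
          exact this.le
        · rintro ⟨j, hj, hj'⟩
          rcases Nat.lt_or_ge i j with hij | hij
          · have := c.monotone_sizeUpTo (show i + 1 ≤ j from hij)
            omega
          · have := c.monotone_sizeUpTo hij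
            omega
    · intro h p hp hno
      set i := c.index ⟨p, by omega⟩ with hi
      have h1 := c.sizeUpTo_index_le ⟨p, by omega⟩
      have h2 := c.lt_sizeUpTo_index_succ ⟨p, by omega⟩
      rw [← hi] at h1 h2
      have hiL : (i : ℕ) < L.length := by have := i.2; omega
      simp only [Fin.val_succ] at h1 h2
      have hs := hsucc i hiL
      have hl := hlast i hiL
      have hf := hfst i hiL
      have hne : c.sizeUpTo (i + 1) ≠ p + 1 := by
        intro he
        by_cases hlt : (i : ℕ) + 1 < c.length
        · exact hno ⟨i + 1, hlt, he⟩
        · rw [c.sizeUpTo_ofLength_le _ (by omega)] at he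
          omega
      have hle := h _ (List.getElem_mem hiL)
      unfold blk at hs
      split_ifs at hs with he
      · omega
      · have : c.sizeUpTo i = p := by omega
        rw [this] at hs hf
        rw [hs, show p + 2 - 1 = p + 1 by omega] at hl
        rw [hf, hl]
        omega
  have htrans : L.Pairwise (fun p p' => p.1 < p'.1 ∧ p.2 < p'.2) ↔
      ∀ i (h : i + 1 < L.length), L[i].1 < L[i + 1].1 ∧ L[i].2 < L[i + 1].2 := by
    have : IsTrans (ℕ × ℕ) (fun p p' => p.1 < p'.1 ∧ p.2 < p'.2) :=
      ⟨fun a b c h h' => ⟨h.1.trans h'.1, h.2.trans h'.2⟩⟩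
    rw [← List.isChain_iff_pairwise, List.isChain_iff_getElem]
  have hC : ∀ i (h : i + 1 < L.length), L[i].1 ≤ L[i].2 → L[i + 1].1 ≤ L[i + 1].2 →
      L[i].1 < L[i + 1].1 →
      (((flatB L).getD (c.sizeUpTo (i + 1)) 0 < (flatB L).getD (c.sizeUpTo (i + 1) - 1) 0 →
    ∃ a j : ℕ, 1 ≤ j ∧ c.sizeUpTo i ≤ a ∧ a + j + 1 ≤ c.sizeUpTo (i + 2) ∧
      redL (((flatB L).drop a).take (j + 1)) ∈ ({[1, 3, 2, 4], [1, 2, 3]} : Set (List ℕ))) ↔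
      L[i].2 < L[i + 1].2) := by
    intro i h h1 h2 h3
    have hdd := hd1 i (by omega)
    rw [List.drop_eq_getElem_cons h, flt_cons] at hdd
    have hne : L[i].2 ≠ L[i + 1].1 := by
      have : ((flatB L).drop (c.sizeUpTo i)).Nodup := hnd.sublist (List.drop_sublist _ _)
      rw [hdd, List.nodup_append] at this
      exact this.2.2 _ (snd_mem_brk _) _ (List.mem_append_left _ (fst_mem_brk _))
    rw [← local_match L[i] L[i + 1] (flatB (L.drop (i + 1 + 1))) h1 h2 hne h3, hfst _ h,
      hlast i (by omega)]
    have hs1 := hsucc i (by omega)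
    have hs2 := hsucc (i + 1) h
    refine imp_congr Iff.rfl ?_
    constructor
    · rintro ⟨a, j, hj, ha, ha', hr⟩
      obtain ⟨a, rfl⟩ := Nat.exists_eq_add_of_le ha
      refine ⟨a, j, hj, by rw [show i + 2 = i + 1 + 1 from rfl] at ha'; omega, ?_⟩
      rwa [← hdd, List.drop_drop]
    · rintro ⟨a, j, hj, ha, hr⟩
      refine ⟨c.sizeUpTo i + a, j, hj, by omega,
        by rw [show i + 2 = i + 1 + 1 from rfl]; omega, ?_⟩
      rwa [← hdd, List.drop_drop] at hr
  unfold FixedPt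
  rw [hA, htrans]
  refine and_congr_right fun hle => ?_
  rw [hlen]
  constructor
  · rintro ⟨hB, hD⟩ i h
    have hlt := hB i h
    rw [hfst i (by omega), hfst _ h] at hlt
    exact ⟨hlt, (hC i h (hle _ (List.getElem_mem _)) (hle _ (List.getElem_mem _)) hlt).1 (hD i h)⟩
  · intro hh
    constructor
    · intro i h
      rw [hfst i (by omega), hfst _ h]
      exact (hh i h).1
    · intro i h
      exact (hC i h (hle _ (List.getElem_mem _)) (hle _ (List.getElem_mem _)) (hh i h).1).2 (hh i h).2

lemma count_blk (L : List (ℕ × ℕ)) :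
    (L.map blk).count 1 + (L.map blk).count 2 = L.length ∧
    (L.map blk).count 1 + 2 * (L.map blk).count 2 = (L.map blk).sum := by
  induction L with
  | nil => simp
  | cons p L ih =>
    simp only [List.map_cons, List.count_cons, List.length_cons, List.sum_cons]
    have : blk p = 1 ∨ blk p = 2 := by unfold blk; split <;> simp
    rcases this with h | h <;> simp [h] <;> omega

lemma sum_ge (B : List ℕ) (hpos : ∀ b ∈ B, 0 < b) : B.count 1 + 2 * B.count 2 ≤ B.sum ∧
    (B.count 1 + 2 * B.count 2 = B.sum → ∀ b ∈ B, b = 1 ∨ b = 2) := by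
  induction B with
  | nil => simp
  | cons b B ih =>
    obtain ⟨h1, h2⟩ := ih (fun x hx => hpos x (by simp [hx]))
    have hb := hpos b (by simp)
    simp only [List.count_cons, List.sum_cons, beq_iff_eq]
    constructor
    · split_ifs <;> omega
    · intro h x hx
      have : (b = 1 ∨ b = 2) ∧ B.count 1 + 2 * B.count 2 = B.sum := by
        split_ifs at h <;> omega
      rcases List.mem_cons.1 hx with rfl | hx
      · exact this.1
      · exact h2 this.2 x hx

lemma build (B : List ℕ) (hB : ∀ b ∈ B, b = 1 ∨ b = 2) (σ : List ℕ) (hσ : σ.length = B.sum)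
    (hnd : σ.Nodup) : ∃ L : List (ℕ × ℕ), L.map blk = B ∧ flatB L = σ := by
  induction B generalizing σ with
  | nil =>
    simp at hσ
    exact ⟨[], by simp, by simp [flatB, hσ]⟩
  | cons b B ih =>
    have ih := ih (fun x hx => hB x (by simp [hx]))
    simp only [List.sum_cons] at hσ
    rcases hB b (by simp) with rfl | rfl
    · match σ, hσ, hnd with
      | [], hσ, _ => simp at hσ; omega
      | x :: σ, hσ, hnd =>
        simp at hσ
        obtain ⟨L, h1, h2⟩ := ih σ (by omega) (List.nodup_cons.1 hnd).2
        exact ⟨(x, x) :: L, by simp [h1, blk], by simp [flt_cons, brk, h2]⟩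
    · match σ, hσ, hnd with
      | [], hσ, _ => simp at hσ; omega
      | [x], hσ, _ => simp at hσ; omega
      | x :: y :: σ, hσ, hnd =>
        simp at hσ
        simp only [List.nodup_cons, List.mem_cons, not_or] at hnd
        obtain ⟨L, h1, h2⟩ := ih σ (by omega) hnd.2.2
        exact ⟨(x, y) :: L, by simp [h1, blk, hnd.1.1], by simp [flt_cons, brk, h2, hnd.1.1]⟩

lemma flt_inj : ∀ (L L' : List (ℕ × ℕ)), L.map blk = L'.map blk → flatB L = flatB L' → L = L'
  | [], [], _, _ => rfl
  | [], p :: L', h, _ => by simp at h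
  | p :: L, [], h, _ => by simp at h
  | p :: L, p' :: L', h, h' => by
    simp only [List.map_cons, List.cons.injEq] at h
    rw [flt_cons, flt_cons] at h'
    obtain ⟨h1, h2⟩ := List.append_inj h' (by rw [brk_length, brk_length, h.1])
    rw [flt_inj L L' h.2 h2]
    have ha := brk_getD_zero p []
    have hb := brk_getD_last p []
    rw [h1, brk_getD_zero] at ha
    rw [h1, h.1, brk_getD_last] at hb
    rw [Prod.ext ha hb]

open scoped Classical in
theorem stmt11 (Γ : Set (List ℕ)) (hΓ : Γ = {[1, 3, 2, 4], [1, 2, 3]})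
    (n k : ℕ) (hk : k ≤ n) :
    ((Finset.filter
        (fun cs : Composition (2 * n + 1) × List ℕ =>
          cs.1.blocks.count 1 = 2 * k + 1 ∧ cs.1.blocks.count 2 = n - k ∧
            FixedPt Γ (2 * n + 1) cs.1 cs.2)
        ((Finset.univ : Finset (Composition (2 * n + 1))) ×ˢ
          (List.range' 1 (2 * n + 1)).permutations.toFinset)).card : ℚ)
      = 2 * ((k : ℚ) + 1) * ((2 * n + 1).choose (n - k) : ℚ) / ((n : ℚ) + k + 2) := by
  subst hΓ
  rw [← final_arith n k hk]
  congr 1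
  have hcard : cnt (2 * n + 1) (2 * n + 1) 0 (n + k + 1) =
      ((W (2 * n + 1) (2 * n + 1)).toFinset.filter
        (fun s => s.1.length = 0 ∧ s.2.length = n + k + 1)).card := by
    unfold cnt
    rw [List.countP_eq_length_filter, ← List.toFinset_card_of_nodup, List.toFinset_filter]
    · simp
    · exact (nodup_W _ _ 0 rfl).filter _
  rw [hcard]
  symm
  have key : ∀ s ∈ (W (2 * n + 1) (2 * n + 1)).toFinset.filter
        (fun s => s.1.length = 0 ∧ s.2.length = n + k + 1),
      Good (2 * n + 1) 0 s ∧ s.1 = [] ∧ s.2.length = n + k + 1 ∧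
        (flatB s.2).Perm (List.range' 1 (2 * n + 1)) ∧ (s.2.map blk).sum = 2 * n + 1 := by
    intro s hs
    rw [Finset.mem_filter, List.mem_toFinset, mem_W _ _ 0 rfl] at hs
    obtain ⟨h1, h2, h3⟩ := hs
    have h2 := List.eq_nil_of_length_eq_zero h2
    have hp := h1.perm
    rw [h2] at hp
    simp only [List.nil_append, Nat.zero_add, Nat.sub_zero] at hp
    refine ⟨h1, h2, h3, hp, ?_⟩
    rw [← flt_length, hp.length_eq, List.length_range']
  refine Finset.card_bij (fun s hs => (⟨s.2.map blk, ?_, (key s hs).2.2.2.2⟩, flatB s.2)) ?_ ?_ ?_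
  · intro i hi
    obtain ⟨p, -, rfl⟩ := List.mem_map.1 hi
    exact blk_pos p
  · intro s hs
    obtain ⟨h1, h2, h3, h4, h5⟩ := key s hs
    have hcb := count_blk s.2
    rw [Finset.mem_filter, Finset.mem_product]
    refine ⟨⟨Finset.mem_univ _, ?_⟩, ?_, ?_, ?_⟩
    · rw [List.mem_toFinset, List.mem_permutations]; exact h4
    · show (s.2.map blk).count 1 = _
      omega
    · show (s.2.map blk).count 2 = _
      omega
    · rw [fixedPt_iff _ _ s.2 rfl (h4.nodup_iff.2 List.nodup_range')]
      exact ⟨h1.le, h1.chain⟩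
  · intro s hs t ht hst
    simp only [Prod.mk.injEq, Composition.mk.injEq] at hst
    exact Prod.ext ((key s hs).2.1.trans (key t ht).2.1.symm) (flt_inj _ _ hst.1 hst.2)
  · rintro ⟨c, σ⟩ hcs
    rw [Finset.mem_filter, Finset.mem_product, List.mem_toFinset, List.mem_permutations] at hcs
    obtain ⟨⟨-, hσ⟩, hc1, hc2, hF⟩ := hcs
    simp only at hσ hc1 hc2 hF
    have hnd : σ.Nodup := hσ.nodup_iff.2 List.nodup_range'
    have hsum := c.blocks_sum
    obtain ⟨L, hL1, hL2⟩ := build c.blocks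
      ((sum_ge c.blocks (fun b hb => c.blocks_pos hb)).2 (by omega)) σ
      (by rw [hσ.length_eq, List.length_range', hsum]) hnd
    subst hL2
    rw [fixedPt_iff _ c L hL1.symm hnd] at hF
    have hcb := count_blk L
    rw [hL1] at hcb
    refine ⟨([], L), ?_, ?_⟩
    · rw [Finset.mem_filter, List.mem_toFinset, mem_W _ _ 0 rfl]
      refine ⟨⟨by simpa using hσ, by simp, hF.1, hF.2, by simp⟩, rfl, ?_⟩
      show L.length = _
      omega
    · exact Prod.ext (Composition.ext hL1) rfl
end
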